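/- arXiv:math/0609047 — 3 statements merged into one kernel-verified Lean document; each statement's English description precedes it below -/
import Mathlib

section
/- Let 𝓗 = 𝓗₁ ∪ 𝓗₂ be an arrangement of topoplanes in ℝⁿ such that every member of 𝓗₁ is disjoint from every member of 𝓗₂, 𝓗₂ is nonempty, and some two distinct members of 𝓗₁ have nonempty intersection. Then 𝓗 is not projectivizable. -/
open Set

/-- The `i`-th coordinate hyperplane in `ℝⁿ` (by convention the whole space if `i ≥ n`). -/
def coordHyp (n i : ℕ) : Set (Fin n → ℝ) := {x | ∀ h : i < n, x ⟨i, h⟩ = 0}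

/-- `H` is a topological hyperplane (topoplane) in `ℝⁿ`: some self-homeomorphism of `ℝⁿ`
carries `H` onto the coordinate hyperplane `{x | x₁ = 0}`. -/
def IsTopoplane {n : ℕ} (H : Set (Fin n → ℝ)) : Prop :=
  ∃ e : (Fin n → ℝ) ≃ₜ (Fin n → ℝ), e '' H = coordHyp n 0

/-- `Z` is a relative topoplane in `Y ⊆ ℝⁿ`: `Z ⊆ Y` and some homeomorphism of `Y`
(with the subspace topology) onto some `ℝᵈ`, `d ≥ 1`, carries `Z` onto `{x | x₁ = 0}`. -/
def IsRelTopoplane {n : ℕ} (Y Z : Set (Fin n → ℝ)) : Prop :=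
  Z ⊆ Y ∧ ∃ d : ℕ, 1 ≤ d ∧ ∃ φ : Y ≃ₜ (Fin d → ℝ),
    φ '' {y : Y | (y : Fin n → ℝ) ∈ Z} = coordHyp d 0

/-- `Y` is a flat of the family `𝓗`: a nonempty intersection of a subfamily of `𝓗`
(the empty intersection being all of `ℝⁿ`). -/
def IsFlat {n : ℕ} (𝓗 : Set (Set (Fin n → ℝ))) (Y : Set (Fin n → ℝ)) : Prop :=
  (∃ 𝓢 ⊆ 𝓗, Y = ⋂₀ 𝓢) ∧ Y.Nonempty

/-- `𝓗` is an arrangement of topoplanes in `ℝⁿ`: a finite set of topoplanes such that for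
every `H ∈ 𝓗` and every flat `Y`, either `Y ⊆ H`, or `H ∩ Y = ∅`, or `H ∩ Y` is a
relative topoplane in `Y`. -/
def IsArrangement {n : ℕ} (𝓗 : Set (Set (Fin n → ℝ))) : Prop :=
  𝓗.Finite ∧ (∀ H ∈ 𝓗, IsTopoplane H) ∧
    ∀ H ∈ 𝓗, ∀ Y : Set (Fin n → ℝ), IsFlat 𝓗 Y →
      Y ⊆ H ∨ H ∩ Y = ∅ ∨ IsRelTopoplane Y (H ∩ Y)

/-- `Y` has dimension `d`: it is homeomorphic, in the subspace topology, to `ℝᵈ`. -/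
def HasDim {n : ℕ} (Y : Set (Fin n → ℝ)) (d : ℕ) : Prop :=
  Nonempty (Y ≃ₜ (Fin d → ℝ))

/-- Topoplanes `H₁`, `H₂` cross: some self-homeomorphism of `ℝⁿ` carries them
simultaneously onto the coordinate hyperplanes `{x | x₁ = 0}` and `{x | x₂ = 0}`. -/
def Crosses {n : ℕ} (H₁ H₂ : Set (Fin n → ℝ)) : Prop :=
  ∃ e : (Fin n → ℝ) ≃ₜ (Fin n → ℝ), e '' H₁ = coordHyp n 0 ∧ e '' H₂ = coordHyp n 1

/-- The pairwise condition for an arrangement to be affine: any two distinct members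
are disjoint or cross. -/
def PairwiseAffine {n : ℕ} (𝓗 : Set (Set (Fin n → ℝ))) : Prop :=
  ∀ H₁ ∈ 𝓗, ∀ H₂ ∈ 𝓗, H₁ ≠ H₂ → H₁ ∩ H₂ = ∅ ∨ Crosses H₁ H₂

/-- The unit `n`-sphere `Sⁿ ⊆ ℝ^{n+1}`, as a topological space. -/
abbrev Sph (n : ℕ) : Type :=
  ↥(Metric.sphere (0 : EuclideanSpace ℝ (Fin (n + 1))) 1)

/-- The equator `Sⁿ ∩ {x : x₁ = 0}` of `Sⁿ` (homeomorphic to `S^{n-1}`). -/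
def sphEquator (n : ℕ) : Set (Sph n) :=
  {x | (x : EuclideanSpace ℝ (Fin (n + 1))) 0 = 0}

/-- `𝓢` is an arrangement of pseudospheres in `Sⁿ`: a finite set of centrally symmetric
pseudospheres such that every subfamily intersection is homeomorphic to a sphere of some
dimension (possibly the empty sphere), and for every subfamily `𝓢'` and `S ∈ 𝓢` with
`⋂𝓢' ⊄ S`, some homeomorphism from `⋂𝓢'` onto a standard sphere `S^d` carries `S ∩ ⋂𝓢'`
onto an equator `S^{d-1}`. -/
def IsPseudosphereArr {n : ℕ} (𝓢 : Set (Set (Sph n))) : Prop :=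
  𝓢.Finite ∧
  (∀ S ∈ 𝓢,
    (∀ x ∈ S, ∀ y : Sph n,
      (y : EuclideanSpace ℝ (Fin (n + 1))) = -(x : EuclideanSpace ℝ (Fin (n + 1))) →
        y ∈ S) ∧
    ∃ e : Sph n ≃ₜ Sph n, e '' S = sphEquator n) ∧
  (∀ 𝓢' ⊆ 𝓢, ⋂₀ 𝓢' = (∅ : Set (Sph n)) ∨
    ∃ d : ℕ, Nonempty (↥(⋂₀ 𝓢') ≃ₜ Sph d)) ∧
  (∀ 𝓢' ⊆ 𝓢, ∀ S ∈ 𝓢, ¬⋂₀ 𝓢' ⊆ S →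
    ∃ d : ℕ, ∃ ψ : ↥(⋂₀ 𝓢') ≃ₜ Sph d,
      ψ '' {y : ↥(⋂₀ 𝓢') | (y : Sph n) ∈ S} = sphEquator d)

/-- `𝓐` is projectivizable: there are an arrangement of pseudospheres `𝓢` in `Sⁿ`, a
member `S₀ ∈ 𝓢`, a connected component `D` of `Sⁿ ∖ S₀` and a homeomorphism `f` from `ℝⁿ`
onto `D` with `{f(A) : A ∈ 𝓐} = {S ∩ D : S ∈ 𝓢, S ≠ S₀}`. -/
def Projectivizable {n : ℕ} (𝓐 : Set (Set (Fin n → ℝ))) : Prop :=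
  ∃ 𝓢 : Set (Set (Sph n)), IsPseudosphereArr 𝓢 ∧
    ∃ S₀ ∈ 𝓢, ∃ D : Set (Sph n),
      (∃ x ∈ S₀ᶜ, D = connectedComponentIn S₀ᶜ x) ∧
      ∃ f : (Fin n → ℝ) ≃ₜ ↥D,
        {B : Set (Sph n) | ∃ A ∈ 𝓐, B = Subtype.val '' (⇑f '' A)} =
          {B : Set (Sph n) | ∃ S ∈ 𝓢, S ≠ S₀ ∧ B = S ∩ D}

open MeasureTheory Metric Filter Topology

/-- A perturbation of the identity by a strict contraction is bijective. -/
theorem bijective_id_add_of_lipschitzWith {E : Type*} [NormedAddCommGroup E] [NormedSpace ℝ E]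
    [CompleteSpace E] {G : E → E} {c : NNReal} (hG : LipschitzWith c G) (hc : c < 1) :
    Function.Bijective fun x => x + G x := by
  have happ : ApproximatesLinearOn (fun x => x + G x)
      ((ContinuousLinearEquiv.refl ℝ E : E ≃L[ℝ] E) : E →L[ℝ] E) univ c := by
    rw [ApproximatesLinearOn.approximatesLinearOn_iff_lipschitzOnWith]
    refine LipschitzWith.lipschitzOnWith ?_
    convert hG using 1
    ext x
    simp
  have hN : Subsingleton E ∨
      c < ‖((ContinuousLinearEquiv.refl ℝ E).symm : E →L[ℝ] E)‖₊⁻¹ := by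
    rcases subsingleton_or_nontrivial E with h | h
    · exact Or.inl h
    · right
      simpa using hc
  exact ⟨injOn_univ.mp (happ.injOn hN), happ.surjective hN⟩

/-- A bijection which is the identity off `s` maps `s` onto itself. -/
theorem Function.Bijective.image_eq_self_of_eqOn_compl {α : Type*} {f : α → α}
    (hf : Function.Bijective f) {s : Set α} (h : ∀ x ∉ s, f x = x) : f '' s = s := by
  apply Subset.antisymm
  · rintro _ ⟨x, hx, rfl⟩
    by_contra hfx
    exact hfx (by rwa [hf.1 (h _ hfx)])
  · intro y hy
    obtain ⟨x, rfl⟩ := hf.2 y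
    by_cases hx : x ∈ s
    · exact ⟨x, hx, rfl⟩
    · rw [h x hx] at hy
      exact absurd hy hx

section DegreeIntegral

variable {n : ℕ}

/-- Evaluation of a polynomial with continuous coefficients at a point `x` and a scalar `t`. -/
noncomputable def evalAt (x : EuclideanSpace ℝ (Fin n)) (t : ℝ) :
    Polynomial C(EuclideanSpace ℝ (Fin n), ℝ) →+* ℝ :=
  Polynomial.eval₂RingHom
    ((ContinuousMap.evalAlgHom ℝ ℝ x : C(EuclideanSpace ℝ (Fin n), ℝ) →ₐ[ℝ] ℝ) : _ →+* ℝ) t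

/-- Integrating over a compact set a polynomial in `t` with continuous coefficients gives a
polynomial in `t`. -/
theorem exists_eval_eq_setIntegral_evalAt {B : Set (EuclideanSpace ℝ (Fin n))} (hB : IsCompact B)
    (P : Polynomial C(EuclideanSpace ℝ (Fin n), ℝ)) :
    ∃ Q : Polynomial ℝ, ∀ t, Q.eval t = ∫ x in B, evalAt x t P := by
  refine ⟨∑ i ∈ Finset.range (P.natDegree + 1),
    Polynomial.C (∫ x in B, P.coeff i x) * Polynomial.X ^ i, fun t => ?_⟩
  have : ∀ x, evalAt x t P = ∑ i ∈ Finset.range (P.natDegree + 1), P.coeff i x * t ^ i := by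
    intro x
    simp [evalAt, Polynomial.eval₂_eq_sum_range]
  simp_rw [this]
  rw [integral_finsetSum]
  · simp [Polynomial.eval_finsetSum, integral_mul_const]
  · intro i _
    exact ((P.coeff i).continuous.mul continuous_const).continuousOn.integrableOn_compact hB

/-- The integrand of the degree formula is polynomial in the parameter `t`. -/
theorem exists_evalAt_eq_weight_mul_det {G : EuclideanSpace ℝ (Fin n) → EuclideanSpace ℝ (Fin n)}
    (hG : ContDiff ℝ 1 G) (k : ℕ) :
    ∃ P : Polynomial C(EuclideanSpace ℝ (Fin n), ℝ), ∀ x t,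
      evalAt x t P = (1 - ‖x + t • G x‖ ^ 2 / 16) ^ k *
        (ContinuousLinearMap.id ℝ _ + t • fderiv ℝ G x).det := by
  have hG' : Continuous (fderiv ℝ G) := hG.continuous_fderiv (by norm_num)
  have hGc : Continuous G := hG.continuous
  let b := (EuclideanSpace.basisFun (Fin n) ℝ).toBasis
  let cx : Fin n → C(EuclideanSpace ℝ (Fin n), ℝ) := fun i => ⟨fun x => x i, by fun_prop⟩
  let cg : Fin n → C(EuclideanSpace ℝ (Fin n), ℝ) := fun i => ⟨fun x => G x i, by fun_prop⟩
  let cd : Fin n → Fin n → C(EuclideanSpace ℝ (Fin n), ℝ) := fun i j =>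
    ⟨fun x => (fderiv ℝ G x (b j)) i, by fun_prop⟩
  let M : Matrix (Fin n) (Fin n) (Polynomial C(EuclideanSpace ℝ (Fin n), ℝ)) :=
    1 + Matrix.of fun i j => Polynomial.X * Polynomial.C (cd i j)
  let c16 : C(EuclideanSpace ℝ (Fin n), ℝ) := ContinuousMap.const _ (1 / 16)
  refine ⟨(1 - (∑ i, (Polynomial.C (cx i) + Polynomial.X * Polynomial.C (cg i)) ^ 2) *
    Polynomial.C c16) ^ k * M.det, fun x t => ?_⟩
  have hC : ∀ c : C(EuclideanSpace ℝ (Fin n), ℝ), evalAt x t (Polynomial.C c) = c x := by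
    intro c; simp [evalAt]
  have hX : evalAt x t (Polynomial.X : Polynomial C(EuclideanSpace ℝ (Fin n), ℝ)) = t := by
    simp [evalAt]
  rw [map_mul, map_pow, map_sub, map_mul, map_sum, map_one, hC, RingHom.map_det]
  congr 1
  · rw [EuclideanSpace.real_norm_sq_eq, div_eq_mul_one_div]
    simp [hC, hX, cx, cg, c16, mul_comm t]
  · rw [ContinuousLinearMap.det, ← LinearMap.det_toMatrix b]
    congr 1
    ext i j
    by_cases hij : i = j
    · subst hij
      simp [M, hC, hX, cd, LinearMap.toMatrix_apply, b, mul_comm t]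
    · simp [M, hC, hX, cd, LinearMap.toMatrix_apply, b, hij, mul_comm t]

/-- The degree formula for a map equal to the identity off the ball of radius `2`. -/
theorem setIntegral_weight_mul_det {G : EuclideanSpace ℝ (Fin n) → EuclideanSpace ℝ (Fin n)}
    (hG : ContDiff ℝ 1 G) (hG0 : ∀ x, 2 ≤ ‖x‖ → G x = 0) (k : ℕ) :
    ∫ x in closedBall (0 : EuclideanSpace ℝ (Fin n)) 2, (1 - ‖x + G x‖ ^ 2 / 16) ^ k *
        (ContinuousLinearMap.id ℝ _ + fderiv ℝ G x).det =
      ∫ x in closedBall (0 : EuclideanSpace ℝ (Fin n)) 2, (1 - ‖x‖ ^ 2 / 16) ^ k := by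
  have hB : IsCompact (closedBall (0 : EuclideanSpace ℝ (Fin n)) 2) := isCompact_closedBall 0 2
  have hG' : Continuous (fderiv ℝ G) := hG.continuous_fderiv (by norm_num)
  obtain ⟨P, hP⟩ := exists_evalAt_eq_weight_mul_det hG k
  obtain ⟨Q, hQ⟩ := exists_eval_eq_setIntegral_evalAt hB P
  have hsupp : HasCompactSupport G := by
    refine HasCompactSupport.intro hB fun x hx => hG0 x ?_
    simp only [mem_closedBall, dist_zero_right, not_le] at hx
    exact hx.le
  obtain ⟨K, hK⟩ := hG.lipschitzWith_of_hasCompactSupport hsupp (by norm_num)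
  have hpos : ∀ᶠ t in 𝓝 (0 : ℝ), ∀ x ∈ closedBall (0 : EuclideanSpace ℝ (Fin n)) 2,
      0 < (ContinuousLinearMap.id ℝ _ + t • fderiv ℝ G x).det := by
    refine hB.eventually_forall_of_forall_eventually fun x _ => ?_
    have hc : Continuous fun z : ℝ × EuclideanSpace ℝ (Fin n) =>
        (ContinuousLinearMap.id ℝ _ + z.1 • fderiv ℝ G z.2).det :=
      ContinuousLinearMap.continuous_det.comp (by fun_prop)
    refine hc.continuousAt.eventually (lt_mem_nhds ?_)
    simp [ContinuousLinearMap.det]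
  have hsmall : ∀ᶠ t in 𝓝 (0 : ℝ), ‖t‖₊ * K < 1 := by
    have hc : Continuous fun t : ℝ => ‖t‖₊ * K := by fun_prop
    exact hc.continuousAt.eventually (gt_mem_nhds (by simp))
  have hev : ∀ᶠ t in 𝓝 (0 : ℝ), Q.eval t =
      ∫ x in closedBall (0 : EuclideanSpace ℝ (Fin n)) 2, (1 - ‖x‖ ^ 2 / 16) ^ k := by
    filter_upwards [hpos, hsmall] with t hdet ht
    have hbij : Function.Bijective fun x => x + (t • G) x :=
      bijective_id_add_of_lipschitzWith (lipschitzWith_smul t |>.comp hK) ht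
    have himg := hbij.image_eq_self_of_eqOn_compl
      (s := closedBall (0 : EuclideanSpace ℝ (Fin n)) 2) fun x hx => by
        simp only [mem_closedBall, dist_zero_right, not_le] at hx
        simp [hG0 x hx.le]
    have hcv := integral_image_eq_integral_abs_det_fderiv_smul
      (volume : Measure (EuclideanSpace ℝ (Fin n))) measurableSet_closedBall
      (s := closedBall (0 : EuclideanSpace ℝ (Fin n)) 2)
      (f := fun x => x + (t • G) x)
      (f' := fun x => ContinuousLinearMap.id ℝ _ + t • fderiv ℝ G x)
      (fun x _ => ((hasFDerivAt_id x).add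
        (((hG.differentiable (by norm_num)) x).hasFDerivAt.const_smul t)).hasFDerivWithinAt)
      hbij.1.injOn (fun y => (1 - ‖y‖ ^ 2 / 16) ^ k)
    rw [himg] at hcv
    rw [hcv, hQ]
    refine setIntegral_congr_fun measurableSet_closedBall fun x hx => ?_
    simp only [hP, abs_of_pos (hdet x hx), smul_eq_mul, Pi.smul_apply]
    ring
  obtain ⟨ε, hε, hball⟩ := Metric.eventually_nhds_iff_ball.mp hev
  have hQC : Q = Polynomial.C
      (∫ x in closedBall (0 : EuclideanSpace ℝ (Fin n)) 2, (1 - ‖x‖ ^ 2 / 16) ^ k) := by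
    refine Polynomial.eq_of_infinite_eval_eq _ _ (Set.Infinite.mono ?_ (Ioo_infinite hε))
    intro t ht
    simp only [mem_ofPred_eq, Polynomial.eval_C]
    refine hball t ?_
    rw [mem_ball, dist_zero_right, Real.norm_eq_abs, abs_of_pos ht.1]
    exact ht.2
  have h1 := hQ 1
  rw [hQC, Polynomial.eval_C] at h1
  rw [h1]
  simp [hP]

/-- A `C¹` map equal to the identity off the ball of radius `2` has a zero. -/
theorem exists_add_eq_zero_of_contDiff
    {G : EuclideanSpace ℝ (Fin n) → EuclideanSpace ℝ (Fin n)}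
    (hG : ContDiff ℝ 1 G) (hG0 : ∀ x, 2 ≤ ‖x‖ → G x = 0) (hG2 : ∀ x, ‖G x‖ ≤ 2) :
    ∃ x, x + G x = 0 := by
  by_contra! hne
  have hG' : Continuous (fderiv ℝ G) := hG.continuous_fderiv (by norm_num)
  have hGc : Continuous G := hG.continuous
  set B := closedBall (0 : EuclideanSpace ℝ (Fin n)) 2 with hBdef
  have hB : IsCompact B := isCompact_closedBall 0 2
  obtain ⟨x₀, hx₀, hmin⟩ := hB.exists_isMinOn ⟨0, by simp [hBdef]⟩
    (f := fun x => ‖x + G x‖) (by fun_prop)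
  set δ := ‖x₀ + G x₀‖ with hδ
  have hδpos : 0 < δ := norm_pos_iff.mpr (hne x₀)
  have hle4 : ∀ x ∈ B, ‖x + G x‖ ≤ 4 := fun x hx => by
    have : ‖x‖ ≤ 2 := by simpa [hBdef] using hx
    linarith [norm_add_le x (G x), hG2 x]
  have hδ4 : δ ≤ 4 := hle4 x₀ hx₀
  set d : EuclideanSpace ℝ (Fin n) → ℝ := fun x =>
    (ContinuousLinearMap.id ℝ _ + fderiv ℝ G x).det with hd
  have hdc : Continuous d := ContinuousLinearMap.continuous_det.comp (by fun_prop)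
  obtain ⟨C, hC⟩ := hB.exists_bound_of_continuousOn hdc.continuousOn
  set a := 1 - δ ^ 2 / 16
  set b := 1 - (δ / 2) ^ 2 / 16 with hb
  have hab : a < b := by simp only [a, b]; nlinarith
  have ha0 : 0 ≤ a := by simp only [a]; nlinarith
  have hb0 : 0 < b := ha0.trans_lt hab
  set W := (volume : Measure (EuclideanSpace ℝ (Fin n))).real
    (closedBall (0 : EuclideanSpace ℝ (Fin n)) (δ / 2))
  have hW : 0 < W := by
    apply ENNReal.toReal_pos
    · exact (measure_closedBall_pos (volume : Measure (EuclideanSpace ℝ (Fin n))) 0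
        (half_pos hδpos)).ne'
    · exact (isCompact_closedBall _ _).measure_ne_top
  have hkey : ∀ k : ℕ, b ^ k * W ≤ a ^ k * (C * volume.real B) := by
    intro k
    have hub : ∫ x in B, (1 - ‖x + G x‖ ^ 2 / 16) ^ k * d x ≤ (a ^ k * C) * volume.real B := by
      have hBfin : volume B < ⊤ := hB.measure_lt_top
      refine (Real.le_norm_self _).trans (norm_setIntegral_le_of_norm_le_const hBfin fun x hx => ?_)
      rw [norm_mul, norm_pow]
      have h1 : δ ≤ ‖x + G x‖ := hmin hx
      have h2 := hle4 x hx
      have h3 : ‖1 - ‖x + G x‖ ^ 2 / 16‖ ≤ a := by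
        rw [Real.norm_eq_abs, abs_of_nonneg (by nlinarith)]
        simp only [a]; nlinarith
      gcongr
      exact hC x hx
    have hlb : b ^ k * W ≤ ∫ x in B, (1 - ‖x‖ ^ 2 / 16) ^ k := by
      have hcont : Continuous fun x : EuclideanSpace ℝ (Fin n) => (1 - ‖x‖ ^ 2 / 16) ^ k := by
        fun_prop
      have hsub : closedBall (0 : EuclideanSpace ℝ (Fin n)) (δ / 2) ⊆ B :=
        closedBall_subset_closedBall (by linarith)
      calc b ^ k * W = ∫ x in closedBall (0 : EuclideanSpace ℝ (Fin n)) (δ / 2), b ^ k := by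
            rw [setIntegral_const, smul_eq_mul, mul_comm]
        _ ≤ ∫ x in closedBall (0 : EuclideanSpace ℝ (Fin n)) (δ / 2), (1 - ‖x‖ ^ 2 / 16) ^ k := by
            refine setIntegral_mono_on
              (continuous_const.continuousOn.integrableOn_compact (isCompact_closedBall _ _))
              (hcont.continuousOn.integrableOn_compact (isCompact_closedBall _ _))
              measurableSet_closedBall fun x hx => ?_
            have : ‖x‖ ≤ δ / 2 := by simpa using hx
            have := norm_nonneg x
            gcongr
            simp only [b]
            gcongr
        _ ≤ ∫ x in B, (1 - ‖x‖ ^ 2 / 16) ^ k := by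
            refine setIntegral_mono_set (hcont.continuousOn.integrableOn_compact hB) ?_
              hsub.eventuallyLE
            refine (ae_restrict_iff' measurableSet_closedBall).mpr (ae_of_all _ fun x hx => ?_)
            have : ‖x‖ ≤ 2 := by simpa using hx
            have := norm_nonneg x
            exact pow_nonneg (by nlinarith) k
    rw [← setIntegral_weight_mul_det hG hG0 k] at hlb
    linarith
  have hlim : Tendsto (fun k : ℕ => (a / b) ^ k * (C * volume.real B)) atTop (𝓝 0) := by
    simpa using (tendsto_pow_atTop_nhds_zero_of_lt_one (div_nonneg ha0 hb0.le)
      ((div_lt_one hb0).mpr hab)).mul_const (C * volume.real B)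
  refine absurd (ge_of_tendsto' hlim fun k => ?_) (not_le.mpr hW)
  have hbk : 0 < b ^ k := pow_pos hb0 k
  rw [div_pow, div_mul_eq_mul_div, le_div_iff₀ hbk]
  linarith [hkey k]

/-- **Brouwer's fixed point theorem**, for continuous self-maps of Euclidean space with values in
the closed unit ball. -/
theorem exists_fixedPoint_of_continuous_of_norm_le_one
    {σ : EuclideanSpace ℝ (Fin n) → EuclideanSpace ℝ (Fin n)}
    (hσ : Continuous σ) (hσ1 : ∀ x, ‖σ x‖ ≤ 1) : ∃ x, σ x = x := by
  by_contra! hne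
  set c : EuclideanSpace ℝ (Fin n) → ℝ := fun x => max 0 (2 - max 1 ‖x‖) with hc
  have hc0 : ∀ x, 0 ≤ c x := fun x => le_max_left _ _
  have hc1 : ∀ x, c x ≤ 1 := fun x => max_le zero_le_one (by linarith [le_max_left 1 ‖x‖])
  have hcin : ∀ x, ‖x‖ ≤ 1 → c x = 1 := fun x hx => by
    simp only [c, max_eq_left hx]; norm_num
  have hcout : ∀ x, 2 ≤ ‖x‖ → c x = 0 := fun x hx => by
    simp only [c]
    exact max_eq_left (by linarith [le_max_right 1 ‖x‖])
  set F : EuclideanSpace ℝ (Fin n) → EuclideanSpace ℝ (Fin n) := fun x => -(c x • σ x) with hF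
  have hFc : Continuous F := by fun_prop
  have hF1 : ∀ x, ‖F x‖ ≤ 1 := fun x => by
    rw [hF, norm_neg, norm_smul, Real.norm_of_nonneg (hc0 x)]
    exact mul_le_one₀ (hc1 x) (norm_nonneg _) (hσ1 x)
  have hFne : ∀ x, x + F x ≠ 0 := by
    intro x hx
    have hx' : x = c x • σ x := by simpa [F, add_neg_eq_zero] using hx
    have hx1 : ‖x‖ ≤ 1 := by
      have := hF1 x
      rwa [hF, norm_neg, ← hx'] at this
    rw [hcin x hx1, one_smul] at hx'
    exact hne x hx'.symm
  obtain ⟨x₀, hx₀, hmin⟩ := (isCompact_closedBall (0 : EuclideanSpace ℝ (Fin n)) 2).exists_isMinOn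
    ⟨0, by simp⟩ (f := fun x => ‖x + F x‖) (by fun_prop)
  have hδ : 0 < ‖x₀ + F x₀‖ := norm_pos_iff.mpr (hFne x₀)
  obtain ⟨G, hG, hGF, hGsupp⟩ := hFc.exists_contDiff_approx 1
    (ε := fun _ => min 1 ‖x₀ + F x₀‖) continuous_const fun _ => lt_min one_pos hδ
  have hG0 : ∀ x, 2 ≤ ‖x‖ → G x = 0 := fun x hx => by
    have hFx : F x = 0 := by simp [F, hcout x hx]
    by_contra h
    exact hGsupp h hFx
  obtain ⟨x, hx⟩ := exists_add_eq_zero_of_contDiff (by exact_mod_cast hG) hG0 fun x => by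
    have h1 := (hGF x).trans_le (min_le_left _ _)
    rw [dist_eq_norm] at h1
    have h2 := norm_add_le (G x - F x) (F x)
    rw [sub_add_cancel] at h2
    linarith [hF1 x]
  have hxG : G x = -x := (neg_eq_of_add_eq_zero_right hx).symm
  have hx2 : ‖x‖ ≤ 2 := by
    by_contra! h
    have h0 : G x = 0 := hG0 x h.le
    rw [hxG, neg_eq_zero] at h0
    rw [h0, norm_zero] at h
    linarith
  have h1 := (hGF x).trans_le (min_le_right _ _)
  have h2 : ‖x₀ + F x₀‖ ≤ ‖x + F x‖ := hmin (by simpa using hx2)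
  rw [hxG, dist_eq_norm, ← norm_neg] at h1
  rw [show -(-x - F x) = x + F x by abel] at h1
  exact absurd h1 (not_lt.mpr h2)

end DegreeIntegral

section Separation

/-- The complement of `A` consists of two disjoint connected open sets, each having all of `A` in
its closure. -/
def Separates {X : Type*} [TopologicalSpace X] (A : Set X) : Prop :=
  ∃ V W : Set X, IsOpen V ∧ IsOpen W ∧ IsConnected V ∧ IsConnected W ∧ Disjoint V W ∧
    Aᶜ = V ∪ W ∧ A ⊆ closure V ∧ A ⊆ closure W

variable {X Y : Type*} [TopologicalSpace X] [TopologicalSpace Y]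

theorem Separates.of_homeomorph {A : Set X} {B : Set Y} (ψ : X ≃ₜ Y) (h : ψ '' A = B)
    (hB : Separates B) : Separates A := by
  have hA : A = ψ ⁻¹' B := by rw [← h, ψ.preimage_image]
  obtain ⟨V, W, hV, hW, hVc, hWc, hVW, hBc, hBV, hBW⟩ := hB
  refine ⟨ψ ⁻¹' V, ψ ⁻¹' W, hV.preimage ψ.continuous, hW.preimage ψ.continuous,
    ψ.isConnected_preimage.mpr hVc, ψ.isConnected_preimage.mpr hWc, hVW.preimage ψ, ?_, ?_, ?_⟩
  · rw [hA, ← preimage_compl, hBc, preimage_union]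
  · rw [hA, ← ψ.preimage_closure]
    exact preimage_mono hBV
  · rw [hA, ← ψ.preimage_closure]
    exact preimage_mono hBW

theorem Separates.subset_of_subset {A B : Set X} (hA : Separates A) (hB : Separates B)
    (hAB : A ⊆ B) : B ⊆ A := by
  obtain ⟨V, W, hV, hW, hVc, hWc, hVW, hBc, hBV, hBW⟩ := hB
  have key : ∀ U₁ U₂ : Set X, IsOpen U₁ → IsOpen U₂ → U₂.Nonempty → Disjoint U₁ U₂ →
      Aᶜ = U₁ ∪ U₂ → ∀ p ∈ B, p ∉ U₁ := by
    intro U₁ U₂ hU₁ hU₂ hne hdisj hAc p hpB hpU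
    have hsub : V ∪ W ⊆ U₁ ∪ U₂ := by
      rw [← hBc, ← hAc]
      exact compl_subset_compl.mpr hAB
    have hVU : V ⊆ U₁ := IsPreconnected.subset_left_of_subset_union hU₁ hU₂ hdisj
      (subset_union_left.trans hsub)
      (by rw [inter_comm]; exact mem_closure_iff.mp (hBV hpB) U₁ hU₁ hpU) hVc.isPreconnected
    have hWU : W ⊆ U₁ := IsPreconnected.subset_left_of_subset_union hU₁ hU₂ hdisj
      (subset_union_right.trans hsub)
      (by rw [inter_comm]; exact mem_closure_iff.mp (hBW hpB) U₁ hU₁ hpU) hWc.isPreconnected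
    obtain ⟨q, hq⟩ := hne
    have hqB : q ∈ B := by
      by_contra h
      have : q ∈ V ∪ W := hBc ▸ h
      exact disjoint_left.mp hdisj (union_subset hVU hWU this) hq
    obtain ⟨r, hr, hrV⟩ := mem_closure_iff.mp (hBV hqB) U₂ hU₂ hq
    exact disjoint_left.mp hdisj (hVU hrV) hr
  obtain ⟨U₁, U₂, hU₁, hU₂, hU₁c, hU₂c, hdisj, hAc, -, -⟩ := hA
  intro p hp
  by_contra hpA
  have : p ∈ U₁ ∪ U₂ := hAc ▸ hpA
  rcases this with h | h
  · exact key U₁ U₂ hU₁ hU₂ hU₂c.nonempty hdisj hAc p hp h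
  · exact key U₂ U₁ hU₂ hU₁ hU₁c.nonempty hdisj.symm (by rw [hAc, union_comm]) p hp h

end Separation

section Sphere

variable {d : ℕ}

/-- Radial projection of a nonzero vector to the unit sphere. -/
noncomputable def sphNormalize (v : EuclideanSpace ℝ (Fin (d + 1))) (hv : v ≠ 0) : Sph d :=
  ⟨‖v‖⁻¹ • v, by simp [norm_smul, hv]⟩

theorem continuous_sphNormalize {Y : Type*} [TopologicalSpace Y]
    {g : Y → EuclideanSpace ℝ (Fin (d + 1))} (hg : Continuous g) (h : ∀ y, g y ≠ 0) :
    Continuous fun y => sphNormalize (g y) (h y) := by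
  refine Continuous.subtype_mk ?_ _
  exact (hg.norm.inv₀ fun y => norm_ne_zero_iff.mpr (h y)).smul hg

theorem sphNormalize_coe_eq {v : EuclideanSpace ℝ (Fin (d + 1))} (hv : v ≠ 0) (h : ‖v‖ = 1) :
    (sphNormalize v hv : EuclideanSpace ℝ (Fin (d + 1))) = v := by
  simp [sphNormalize, h]

theorem Sph.norm_coe (x : Sph d) : ‖(x : EuclideanSpace ℝ (Fin (d + 1)))‖ = 1 := by
  simp

theorem Sph.coe_ne_zero (x : Sph d) : (x : EuclideanSpace ℝ (Fin (d + 1))) ≠ 0 :=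
  norm_ne_zero_iff.mp (by rw [x.norm_coe]; exact one_ne_zero)

/-- The open hemisphere of points whose first coordinate has the sign of `s`. -/
def openHemisphere (d : ℕ) (s : ℝ) : Set (Sph d) :=
  {x | 0 < s * (x : EuclideanSpace ℝ (Fin (d + 1))) 0}

theorem continuous_sph_zero :
    Continuous fun x : Sph d => (x : EuclideanSpace ℝ (Fin (d + 1))) 0 := by
  fun_prop

theorem isOpen_openHemisphere (s : ℝ) : IsOpen (openHemisphere d s) :=
  isOpen_lt continuous_const (continuous_const.mul continuous_sph_zero)

theorem sphNormalize_mem_openHemisphere {s : ℝ} {v : EuclideanSpace ℝ (Fin (d + 1))} (hv : v ≠ 0)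
    (h : 0 < s * v 0) : sphNormalize v hv ∈ openHemisphere d s := by
  have : 0 < ‖v‖⁻¹ := inv_pos.mpr (norm_pos_iff.mpr hv)
  simp only [openHemisphere, sphNormalize, mem_ofPred_eq, PiLp.smul_apply, smul_eq_mul]
  nlinarith [mul_pos this h]

theorem isConnected_openHemisphere {s : ℝ} (hs : s ≠ 0) : IsConnected (openHemisphere d s) := by
  let C : Set (EuclideanSpace ℝ (Fin (d + 1))) := {v | 0 < s * v 0}
  have hC : Convex ℝ C := by
    refine convex_halfSpace_gt (f := fun v : EuclideanSpace ℝ (Fin (d + 1)) => s * v 0) ?_ 0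
    constructor
    · intro v w; simp [mul_add]
    · intro c v; simp; ring
  have hCne : C.Nonempty :=
    ⟨EuclideanSpace.single 0 s, by simpa [C] using mul_self_pos.mpr hs⟩
  have hC0 : ∀ v : C, (v : EuclideanSpace ℝ (Fin (d + 1))) ≠ 0 := by
    rintro ⟨v, hv⟩ rfl
    simp [C] at hv
  have : ConnectedSpace C := Subtype.connectedSpace ⟨hCne, hC.isPreconnected⟩
  convert isConnected_range (continuous_sphNormalize continuous_subtype_val hC0)
  ext x
  constructor
  · intro hx
    exact ⟨⟨x, hx⟩, Subtype.ext (sphNormalize_coe_eq _ x.norm_coe)⟩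
  · rintro ⟨v, rfl⟩
    exact sphNormalize_mem_openHemisphere _ v.2

theorem sphEquator_subset_closure_openHemisphere {s : ℝ} (hs : s ≠ 0) :
    sphEquator d ⊆ closure (openHemisphere d s) := by
  intro x hx
  have hx0 : (x : EuclideanSpace ℝ (Fin (d + 1))) 0 = 0 := hx
  let γ : ℝ → EuclideanSpace ℝ (Fin (d + 1)) := fun t =>
    (x : EuclideanSpace ℝ (Fin (d + 1))) + t • EuclideanSpace.single 0 s
  have hγ0 : ∀ t, γ t 0 = t * s := fun t => by simp [γ, hx0]
  have hγ : ∀ t, γ t ≠ 0 := by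
    intro t h
    have ht : t * s = 0 := by rw [← hγ0, h]; rfl
    have ht0 : t = 0 := (mul_eq_zero.mp ht).resolve_right hs
    simp only [γ, ht0, zero_smul, add_zero] at h
    exact x.coe_ne_zero h
  have hc : Continuous fun t => sphNormalize (γ t) (hγ t) :=
    continuous_sphNormalize (by fun_prop) hγ
  have hval : sphNormalize (γ 0) (hγ 0) = x := by
    apply Subtype.ext
    simp [sphNormalize, γ, x.norm_coe]
  have hlim : Tendsto (fun t => sphNormalize (γ t) (hγ t)) (𝓝[>] 0) (𝓝 x) := by
    have := hc.tendsto 0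
    rw [hval] at this
    exact this.mono_left nhdsWithin_le_nhds
  refine mem_closure_of_tendsto hlim ?_
  filter_upwards [self_mem_nhdsWithin] with t ht
  refine sphNormalize_mem_openHemisphere _ ?_
  rw [hγ0]
  have : 0 < s * s := mul_self_pos.mpr hs
  have ht' : 0 < t := ht
  nlinarith [mul_pos ht' this]

theorem disjoint_openHemisphere : Disjoint (openHemisphere d 1) (openHemisphere d (-1)) := by
  rw [disjoint_left]
  intro x hx hx'
  simp only [openHemisphere, mem_ofPred_eq] at hx hx'
  linarith

theorem compl_sphEquator : (sphEquator d)ᶜ = openHemisphere d 1 ∪ openHemisphere d (-1) := by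
  ext x
  simp only [sphEquator, openHemisphere, mem_compl_iff, mem_ofPred_eq, mem_union, one_mul,
    neg_one_mul, neg_pos]
  rw [← ne_eq, ne_iff_lt_or_gt, or_comm]

theorem separates_sphEquator : Separates (sphEquator d) :=
  ⟨_, _, isOpen_openHemisphere 1, isOpen_openHemisphere (-1),
    isConnected_openHemisphere one_ne_zero, isConnected_openHemisphere (by norm_num),
    disjoint_openHemisphere, compl_sphEquator,
    sphEquator_subset_closure_openHemisphere one_ne_zero,
    sphEquator_subset_closure_openHemisphere (by norm_num)⟩

/-- A continuous self-map of the sphere preserving a closed hemisphere has a fixed point. -/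
theorem exists_fixedPoint_of_mapsTo_closedHemisphere {τ : Sph d → Sph d} (hτ : Continuous τ)
    (h : ∀ x : Sph d, 0 ≤ (x : EuclideanSpace ℝ (Fin (d + 1))) 0 →
      0 ≤ (τ x : EuclideanSpace ℝ (Fin (d + 1))) 0) : ∃ x, τ x = x := by
  let lift : EuclideanSpace ℝ (Fin d) → EuclideanSpace ℝ (Fin (d + 1)) := fun y =>
    WithLp.toLp 2 (Fin.cons (√(1 - ‖y‖ ^ 2)) y.ofLp)
  have hlift0 : ∀ y, lift y 0 = √(1 - ‖y‖ ^ 2) := fun y => rfl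
  have hlifts : ∀ y (i : Fin d), lift y i.succ = y i := fun y i => rfl
  have hliftne : ∀ y, lift y ≠ 0 := by
    intro y hy
    have hy0 : y = 0 := by
      ext i
      rw [← hlifts, hy]; rfl
    have := hlift0 y
    rw [hy, hy0] at this
    simp at this
  have hliftc : Continuous lift := by
    refine (PiLp.continuous_toLp 2 _).comp (continuous_pi fun i => ?_)
    refine Fin.cases ?_ (fun j => ?_) i
    · simp only [Fin.cons_zero]; fun_prop
    · simp only [Fin.cons_succ]; fun_prop
  have hliftnn : ∀ y, 0 ≤ (sphNormalize (lift y) (hliftne y) :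
      EuclideanSpace ℝ (Fin (d + 1))) 0 := by
    intro y
    simp only [sphNormalize, PiLp.smul_apply, smul_eq_mul, hlift0]
    positivity
  let tail : EuclideanSpace ℝ (Fin (d + 1)) → EuclideanSpace ℝ (Fin d) := fun v =>
    WithLp.toLp 2 fun i => v i.succ
  have htailc : Continuous tail :=
    (PiLp.continuous_toLp 2 _).comp (continuous_pi fun i => by fun_prop)
  have hnorm : ∀ v, ‖v‖ ^ 2 = v 0 ^ 2 + ‖tail v‖ ^ 2 := by
    intro v
    rw [EuclideanSpace.real_norm_sq_eq, EuclideanSpace.real_norm_sq_eq, Fin.sum_univ_succ]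
  have hnormsph : ∀ x : Sph d, (x : EuclideanSpace ℝ (Fin (d + 1))) 0 ^ 2 + ‖tail x‖ ^ 2 = 1 := by
    intro x
    rw [← hnorm, x.norm_coe, one_pow]
  obtain ⟨y, hy⟩ := exists_fixedPoint_of_continuous_of_norm_le_one
    (σ := fun y => tail (τ (sphNormalize (lift y) (hliftne y))))
    (htailc.comp (continuous_subtype_val.comp (hτ.comp (continuous_sphNormalize hliftc hliftne))))
    (fun y => by
      have := hnormsph (τ (sphNormalize (lift y) (hliftne y)))
      refine abs_le_of_sq_le_sq' (b := 1) ?_ zero_le_one |>.2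
      nlinarith [sq_nonneg ((τ (sphNormalize (lift y) (hliftne y)) :
        EuclideanSpace ℝ (Fin (d + 1))) 0)])
  have hz := hnormsph (τ (sphNormalize (lift y) (hliftne y)))
  have hz0 := h _ (hliftnn y)
  rw [hy] at hz
  refine ⟨sphNormalize (lift y) (hliftne y), Subtype.ext ?_⟩
  set w := τ (sphNormalize (lift y) (hliftne y))
  set z : EuclideanSpace ℝ (Fin (d + 1)) := w.1
  have hzeq : z 0 = √(1 - ‖y‖ ^ 2) := by
    rw [← hz, add_sub_cancel_right, Real.sqrt_sq hz0]
  have hzl : z = lift y := by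
    ext i
    refine Fin.cases ?_ (fun j => ?_) i
    · rw [hlift0, hzeq]
    · rw [hlifts, ← hy]
  rw [sphNormalize_coe_eq _ (by rw [← hzl]; exact Sph.norm_coe _), hzl]

/-- A fixed-point-free involution of the sphere preserving the equator exchanges the two open
hemispheres. -/
theorem mapsTo_openHemisphere_of_involutive {τ : Sph d → Sph d} (hτ : Continuous τ)
    (hinv : Function.Involutive τ) (hfix : ∀ x, τ x ≠ x)
    (heq : MapsTo τ (sphEquator d) (sphEquator d)) :
    MapsTo τ (openHemisphere d 1) (openHemisphere d (-1)) ∧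
      MapsTo τ (openHemisphere d (-1)) (openHemisphere d 1) := by
  have hoff : ∀ {A : Set (Sph d)}, A ⊆ (sphEquator d)ᶜ →
      τ '' A ⊆ openHemisphere d 1 ∪ openHemisphere d (-1) := by
    rintro A hA _ ⟨y, hy, rfl⟩
    rw [← compl_sphEquator]
    intro h
    exact hA hy (by simpa [hinv y] using heq h)
  have hup : openHemisphere d 1 ⊆ (sphEquator d)ᶜ := compl_sphEquator ▸ subset_union_left
  have hlow : openHemisphere d (-1) ⊆ (sphEquator d)ᶜ := compl_sphEquator ▸ subset_union_right
  have hupc : IsConnected (openHemisphere d 1) := isConnected_openHemisphere one_ne_zero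
  have hlowc : IsConnected (openHemisphere d (-1)) := isConnected_openHemisphere (by norm_num)
  have h1 : MapsTo τ (openHemisphere d 1) (openHemisphere d (-1)) := by
    intro x hx
    rcases hoff hup (mem_image_of_mem τ hx) with h | h
    · exfalso
      have hsub : τ '' openHemisphere d 1 ⊆ openHemisphere d 1 :=
        IsPreconnected.subset_left_of_subset_union (isOpen_openHemisphere 1)
          (isOpen_openHemisphere (-1)) disjoint_openHemisphere (hoff hup)
          ⟨τ x, mem_image_of_mem τ hx, h⟩ (hupc.isPreconnected.image τ hτ.continuousOn)
      obtain ⟨y, hy⟩ := exists_fixedPoint_of_mapsTo_closedHemisphere hτ fun y hy => by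
        rcases hy.eq_or_lt with h0 | h0
        · exact (heq (show y ∈ sphEquator d from h0.symm)).ge
        · have : τ y ∈ openHemisphere d 1 :=
            hsub (mem_image_of_mem τ (by simpa [openHemisphere] using h0))
          simp only [openHemisphere, mem_ofPred_eq, one_mul] at this
          exact this.le
      exact hfix y hy
    · exact h
  refine ⟨h1, fun x hx => ?_⟩
  rcases hoff hlow (mem_image_of_mem τ hx) with h | h
  · exact h
  · exfalso
    have hsub : τ '' openHemisphere d (-1) ⊆ openHemisphere d (-1) :=
      IsPreconnected.subset_right_of_subset_union (isOpen_openHemisphere 1)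
        (isOpen_openHemisphere (-1)) disjoint_openHemisphere (hoff hlow)
        ⟨τ x, mem_image_of_mem τ hx, h⟩ (hlowc.isPreconnected.image τ hτ.continuousOn)
    obtain ⟨y, hy⟩ := hupc.nonempty
    have hy' := hsub (mem_image_of_mem τ (h1 hy))
    rw [hinv y] at hy'
    exact disjoint_left.mp disjoint_openHemisphere hy hy'

/-- A component of the complement of a centrally symmetric pseudosphere contains one of any two
antipodal points off the pseudosphere. -/
theorem mem_or_neg_mem_connectedComponentIn_compl {S : Set (Sph d)} (hS : ∀ x ∈ S, -x ∈ S)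
    {e : Sph d ≃ₜ Sph d} (he : e '' S = sphEquator d) {x₀ x : Sph d} (hx₀ : x₀ ∈ Sᶜ)
    (hx : x ∉ S) : x ∈ connectedComponentIn Sᶜ x₀ ∨ -x ∈ connectedComponentIn Sᶜ x₀ := by
  have hSe : S = e ⁻¹' sphEquator d := by rw [← he, e.preimage_image]
  have hcompl : Sᶜ = e ⁻¹' openHemisphere d 1 ∪ e ⁻¹' openHemisphere d (-1) := by
    rw [hSe, ← preimage_compl, compl_sphEquator, preimage_union]
  obtain ⟨h1, h2⟩ := mapsTo_openHemisphere_of_involutive (τ := fun y => e (-e.symm y))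
    (by fun_prop) (fun y => by simp)
    (fun y hy => by
      have hy' := congrArg e.symm hy
      rw [e.symm_apply_apply] at hy'
      have h0 := congrArg (Subtype.val : Sph d → EuclideanSpace ℝ (Fin (d + 1))) hy'
      rw [coe_neg_sphere] at h0
      refine Sph.coe_ne_zero (e.symm y) (PiLp.ext fun i => ?_)
      have hi := congrArg (fun v : EuclideanSpace ℝ (Fin (d + 1)) => v i) h0
      simp only [PiLp.neg_apply, PiLp.zero_apply] at hi ⊢
      linarith)
    (fun y hy => by
      have : e.symm y ∈ S := by rw [hSe]; simpa using hy
      have := hS _ this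
      rwa [hSe] at this)
  have hcomp : ∀ s : ℝ, s ≠ 0 → e ⁻¹' openHemisphere d s ⊆ Sᶜ → x₀ ∈ e ⁻¹' openHemisphere d s →
      e ⁻¹' openHemisphere d s ⊆ connectedComponentIn Sᶜ x₀ := fun s hs hsub hmem =>
    IsPreconnected.subset_connectedComponentIn
      (e.isConnected_preimage.mpr (isConnected_openHemisphere hs)).isPreconnected hmem hsub
  have hx' : x ∈ Sᶜ := hx
  rw [hcompl] at hx'
  have hxx₀ := hx₀
  rw [hcompl] at hxx₀
  have hn1 : x ∈ e ⁻¹' openHemisphere d 1 → -x ∈ e ⁻¹' openHemisphere d (-1) := fun h => by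
    simpa using h1 h
  have hn2 : x ∈ e ⁻¹' openHemisphere d (-1) → -x ∈ e ⁻¹' openHemisphere d 1 := fun h => by
    simpa using h2 h
  rcases hxx₀ with h | h
  · have hsub := hcomp 1 one_ne_zero (hcompl ▸ subset_union_left) h
    exact hx'.imp (fun h' => hsub h') fun h' => hsub (hn2 h')
  · have hsub := hcomp (-1) (by norm_num) (hcompl ▸ subset_union_right) h
    exact hx'.symm.imp (fun h' => hsub h') fun h' => hsub (hn1 h')

end Sphere

section PseudosphereArrangement

variable {n : ℕ} {𝓢 : Set (Set (Sph n))}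

theorem IsPseudosphereArr.neg_mem (h : IsPseudosphereArr 𝓢) {S : Set (Sph n)} (hS : S ∈ 𝓢)
    {x : Sph n} (hx : x ∈ S) : -x ∈ S :=
  (h.2.1 S hS).1 x hx (-x) (coe_neg_sphere x)

theorem IsPseudosphereArr.eq_of_subset (h : IsPseudosphereArr 𝓢) {S T : Set (Sph n)}
    (hS : S ∈ 𝓢) (hT : T ∈ 𝓢) (hST : S ⊆ T) : S = T := by
  obtain ⟨e, he⟩ := (h.2.1 S hS).2
  obtain ⟨e', he'⟩ := (h.2.1 T hT).2
  exact hST.antisymm ((separates_sphEquator.of_homeomorph e he).subset_of_subset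
    (separates_sphEquator.of_homeomorph e' he') hST)

theorem IsPseudosphereArr.inter_subset (h : IsPseudosphereArr 𝓢) {A B C : Set (Sph n)}
    (hA : A ∈ 𝓢) (hB : B ∈ 𝓢) (hC : C ∈ 𝓢) (hAB : ¬A ⊆ B) (hAC : ¬A ⊆ C) (hABC : A ∩ B ⊆ C) :
    A ∩ C ⊆ B := by
  have hsub : {A} ⊆ 𝓢 := singleton_subset_iff.mpr hA
  obtain ⟨_, ψ, hψ⟩ := h.2.2.2 {A} hsub B hB (by rwa [sInter_singleton])
  obtain ⟨_, ψ', hψ'⟩ := h.2.2.2 {A} hsub C hC (by rwa [sInter_singleton])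
  have key := (separates_sphEquator.of_homeomorph ψ hψ).subset_of_subset
    (separates_sphEquator.of_homeomorph ψ' hψ')
    fun y hy => hABC ⟨y.2 A rfl, hy⟩
  exact fun x hx => key (a := ⟨x, by rw [sInter_singleton]; exact hx.1⟩) hx.2

end PseudosphereArrangement

theorem IsTopoplane.nonempty {n : ℕ} {H : Set (Fin n → ℝ)} (h : IsTopoplane H) : H.Nonempty := by
  obtain ⟨e, he⟩ := h
  have : (coordHyp n 0).Nonempty := ⟨0, fun _ => rfl⟩
  rw [← he] at this
  exact this.of_image

/-- if `𝓗 = 𝓗₁ ∪ 𝓗₂` is an arrangement of topoplanes in `ℝⁿ`, every member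
of `𝓗₁` is disjoint from every member of `𝓗₂`, `𝓗₂` is nonempty, and some two distinct
members of `𝓗₁` intersect, then `𝓗` is not projectivizable. -/
theorem statement11 {n : ℕ} (hn : 1 ≤ n) (𝓗₁ 𝓗₂ : Set (Set (Fin n → ℝ)))
    (h𝓗 : IsArrangement (𝓗₁ ∪ 𝓗₂))
    (hdisj : ∀ H₁ ∈ 𝓗₁, ∀ H₂ ∈ 𝓗₂, H₁ ∩ H₂ = ∅)
    (hne : 𝓗₂.Nonempty)
    (hmeet : ∃ H ∈ 𝓗₁, ∃ H' ∈ 𝓗₁, H ≠ H' ∧ (H ∩ H').Nonempty) :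
    ¬Projectivizable (𝓗₁ ∪ 𝓗₂) := by
  rintro ⟨𝓢, h𝓢, S₀, hS₀, D, ⟨x₀, hx₀, rfl⟩, f, hf⟩
  obtain ⟨H, hH, H', hH', hHH', p, hpH, hpH'⟩ := hmeet
  obtain ⟨K, hK⟩ := hne
  obtain ⟨q, hqK⟩ := (h𝓗.2.1 K (Or.inr hK)).nonempty
  have hex : ∀ A ∈ 𝓗₁ ∪ 𝓗₂, ∃ S ∈ 𝓢, ∀ z, (f z : Sph n) ∈ S ↔ z ∈ A := by
    intro A hA
    have hmem : Subtype.val '' (⇑f '' A) ∈ {B : Set (Sph n) | ∃ S ∈ 𝓢, S ≠ S₀ ∧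
        B = S ∩ connectedComponentIn S₀ᶜ x₀} := hf ▸ ⟨A, hA, rfl⟩
    obtain ⟨S, hS, -, hB⟩ := hmem
    refine ⟨S, hS, fun z => ⟨fun hz => ?_, fun hz => ?_⟩⟩
    · have : (f z : Sph n) ∈ Subtype.val '' (⇑f '' A) := hB ▸ ⟨hz, (f z).2⟩
      rwa [Subtype.val_injective.mem_set_image, f.injective.mem_set_image] at this
    · have : (f z : Sph n) ∈ Subtype.val '' (⇑f '' A) :=
        mem_image_of_mem _ (mem_image_of_mem _ hz)
      rw [hB] at this
      exact this.1
  obtain ⟨S, hS, hSf⟩ := hex H (Or.inl hH)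
  obtain ⟨S', hS', hSf'⟩ := hex H' (Or.inl hH')
  obtain ⟨T, hT, hTf⟩ := hex K (Or.inr hK)
  have hoff : ∀ z, (f z : Sph n) ∉ S₀ := fun z => connectedComponentIn_subset _ _ (f z).2
  obtain ⟨e, he⟩ := (h𝓢.2.1 S₀ hS₀).2
  have hmeetT : ∀ {A R : Set _}, A ∈ 𝓗₁ → R ∈ 𝓢 → (∀ z, (f z : Sph n) ∈ R ↔ z ∈ A) →
      R ∩ T ⊆ S₀ := by
    rintro A R hA hR hRf x ⟨hxR, hxT⟩
    by_contra hx
    have hno : ∀ y ∈ connectedComponentIn S₀ᶜ x₀, y ∈ R → y ∉ T := by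
      intro y hy hyR hyT
      obtain ⟨z, hz⟩ := f.surjective ⟨y, hy⟩
      have hzy : (f z : Sph n) = y := by rw [hz]
      rw [← hzy] at hyR hyT
      have : z ∈ A ∩ K := ⟨(hRf z).mp hyR, (hTf z).mp hyT⟩
      rw [hdisj A hA K hK] at this
      exact this
    rcases mem_or_neg_mem_connectedComponentIn_compl (fun _ => h𝓢.neg_mem hS₀) he hx₀ hx with h | h
    · exact hno x h hxR hxT
    · exact hno _ h (h𝓢.neg_mem hR hxR) (h𝓢.neg_mem hT hxT)
  have hpS : (f p : Sph n) ∈ S := (hSf p).mpr hpH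
  have hpS' : (f p : Sph n) ∈ S' := (hSf' p).mpr hpH'
  have hqT : (f q : Sph n) ∈ T := (hTf q).mpr hqK
  have hpT : (f p : Sph n) ∉ T := fun h => by
    have : p ∈ H ∩ K := ⟨hpH, (hTf p).mp h⟩
    rwa [hdisj H hH K hK] at this
  have hqS' : (f q : Sph n) ∉ S' := fun h => by
    have : q ∈ H' ∩ K := ⟨(hSf' q).mp h, hqK⟩
    rwa [hdisj H' hH' K hK] at this
  have hSS' : ¬S ⊆ S' := fun h => by
    have heq := h𝓢.eq_of_subset hS hS' h
    subst heq
    exact hHH' (ext fun z => (hSf z).symm.trans (hSf' z))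
  have h1 : S ∩ S₀ ⊆ T := h𝓢.inter_subset hS hT hS₀ (fun h => hpT (h hpS))
    (fun h => hoff p (h hpS)) (hmeetT hH hS hSf)
  have h2 : T ∩ S₀ ⊆ S' := h𝓢.inter_subset hT hS' hS₀ (fun h => hqS' (h hqT))
    (fun h => hoff q (h hqT)) (inter_comm T S' ▸ hmeetT hH' hS' hSf')
  have h3 : S ∩ S' ⊆ S₀ := h𝓢.inter_subset hS hS₀ hS' (fun h => hoff p (h hpS)) hSS'
    fun x hx => h2 ⟨h1 hx, hx.2⟩
  exact hoff p (h3 ⟨hpS, hpS'⟩)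
end

section
/- In ℝ³ let H₁ = {x : x₁ = 0}, H₂ = {x : x₂ = 0}, H₃ = {x : x₂ = |x₁|}, H₄ = {x : x₃ = 0}, and H₅ = {x : x₂ + x₃ = 0}. Then 𝓗 = {H₁, H₂, H₃, H₄, H₅} is an arrangement of topoplanes in ℝ³, and there is no affine arrangement of topoplanes 𝓗' in ℝ³ whose k-skeleton equals the k-skeleton of 𝓗 for every k with 0 ≤ k ≤ 3. -/
open Set

/-- The `k`-skeleton of an arrangement: the union of all flats of dimension at most `k`. -/
def skeleton {n : ℕ} (𝓗 : Set (Set (Fin n → ℝ))) (k : ℕ) : Set (Fin n → ℝ) :=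
  ⋃₀ {Y | IsFlat 𝓗 Y ∧ ∃ d ≤ k, HasDim Y d}

theorem not_injective_of_continuous_to_complex (f : (Fin 3 → ℝ) → ℂ) (hf : Continuous f) :
    ¬ Function.Injective f := by
  intro hinj
  let h : ℂ → (Fin 3 → ℝ) := fun u => ![u.re, u.im, Real.sqrt (1 - ‖u‖ ^ 2)]
  have hh : Continuous h := by
    refine continuous_pi fun i => ?_
    fin_cases i <;> simp [h] <;> fun_prop
  have hne : ∀ u, h u ≠ -h u := by
    intro u hu
    have h0 := congrFun hu 0
    have h1 := congrFun hu 1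
    have h2 := congrFun hu 2
    simp only [h, Pi.neg_apply, Matrix.cons_val] at h0 h1 h2
    have : u = 0 := Complex.ext (by simp; linarith) (by simp; linarith)
    subst this
    norm_num at h2
  have hodd : ∀ u : ℂ, ‖u‖ = 1 → h (-u) = -h u := by
    intro u hu
    ext i
    fin_cases i <;> simp [h, hu]
  let g : ℂ → ℂ := fun u => f (h u) - f (-h u)
  have hg : Continuous g := by fun_prop
  have hg0 : ∀ u, g u ≠ 0 := fun u hu => hne u (hinj (sub_eq_zero.1 hu))
  have hsc : IsSimplyConnected (univ : Set ℂ) := by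
    have := convex_univ.contractibleSpace (univ_nonempty (α := ℂ))
    exact SimplyConnectedSpace.ofContractible _
  obtain ⟨θ, hθ, hexp⟩ := Complex.exists_continuousOn_eqOn_exp_comp hsc isOpen_univ
    hg.continuousOn (by rintro ⟨u, -, hu⟩; exact hg0 u hu)
  rw [continuousOn_univ] at hθ
  have hexp' : ∀ u, Complex.exp (θ u) = g u := fun u => hexp (mem_univ u)
  let c : ℝ → ℂ := fun t => Complex.exp (t * Complex.I)
  have hc : Continuous c := by fun_prop
  have hcπ : ∀ t, c (t + Real.pi) = - c t := by
    intro t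
    simp only [c]
    push_cast
    rw [add_mul, Complex.exp_add, Complex.exp_pi_mul_I]
    ring
  let L : ℝ → ℂ := fun t => θ (c (t + Real.pi)) - θ (c t)
  have hL : Continuous L := by fun_prop
  have hLe : ∀ t, Complex.exp (L t) = -1 := by
    intro t
    simp only [L]
    rw [Complex.exp_sub, hexp', hexp', hcπ]
    have hn : ‖c t‖ = 1 := Complex.norm_exp_ofReal_mul_I t
    have : g (-c t) = - g (c t) := by simp [g, hodd _ hn]
    rw [this, neg_div, div_self (hg0 _)]
  have hconst := Complex.isCoveringMap_exp.const_of_comp hL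
    (fun s t => Subtype.ext ((hLe s).trans (hLe t).symm)) 0 Real.pi
  have : L 0 + L Real.pi = 0 := by
    simp only [L, hcπ]
    have : c Real.pi = - c 0 := by rw [← hcπ, zero_add]
    rw [this]; simp
  have h0 : L 0 = 0 := by
    rw [← hconst] at this
    linear_combination this / 2
  have := hLe 0
  rw [h0] at this
  norm_num at this

theorem two_le_of_homeomorph {d m : ℕ} (hd : 2 ≤ d) (e : (Fin d → ℝ) ≃ₜ (Fin m → ℝ)) : 2 ≤ m := by
  by_contra! hm
  have hnt : Nontrivial (Fin d → ℝ) := by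
    have : Nonempty (Fin d) := ⟨⟨0, by omega⟩⟩
    infer_instance
  interval_cases m
  · obtain ⟨a, b, hab⟩ := hnt
    exact hab (e.injective (Subsingleton.elim _ _))
  · have hr : 1 < Module.rank ℝ (Fin d → ℝ) := by
      rw [rank_fin_fun]; exact_mod_cast hd
    have h1 := (isConnected_compl_singleton_of_one_lt_rank hr (e.symm 0)).isPreconnected
    have h2 := (h1.image e e.continuous.continuousOn).image (fun v => v 0)
      (continuous_apply 0).continuousOn
    have hmem : ∀ r : ℝ, r ≠ 0 → r ∈ (fun v : Fin 1 → ℝ => v 0) '' (e '' {e.symm 0}ᶜ) := by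
      intro r hr
      refine ⟨fun _ => r, ⟨e.symm fun _ => r, ?_, by simp⟩, rfl⟩
      intro h
      exact hr (congrFun (e.symm.injective h) 0)
    obtain ⟨v, ⟨x, hx, rfl⟩, hv⟩ := h2.ordConnected.out (hmem (-1) (by norm_num))
      (hmem 1 one_ne_zero) (⟨by norm_num, by norm_num⟩ : (0 : ℝ) ∈ Icc (-1) 1)
    apply hx
    rw [mem_singleton_iff, Homeomorph.eq_symm_apply]
    ext i
    rw [Subsingleton.elim i 0]
    exact hv

theorem three_le_of_homeomorph {m : ℕ} (e : (Fin 3 → ℝ) ≃ₜ (Fin m → ℝ)) : 3 ≤ m := by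
  have h2 := two_le_of_homeomorph (by norm_num) e
  by_contra! hm
  obtain rfl : m = 2 := by omega
  refine not_injective_of_continuous_to_complex
    (fun x => Complex.equivRealProdCLM.symm (e x 0, e x 1)) (by fun_prop) ?_
  intro x y hxy
  have := Complex.equivRealProdCLM.symm.injective hxy
  simp only [Prod.mk.injEq] at this
  apply e.injective
  ext i
  fin_cases i
  · exact this.1
  · exact this.2

open Topology

/-- The open half-line of reals of the sign prescribed by `b` (positive for `true`). -/
def HasSign (b : Bool) (r : ℝ) : Prop := if b then 0 < r else r < 0

theorem HasSign.ne_zero {b : Bool} {r : ℝ} (h : HasSign b r) : r ≠ 0 := by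
  cases b
  · exact (show r < 0 from h).ne
  · exact (show 0 < r from h).ne'

theorem HasSign.unique {a b : Bool} {r : ℝ} (ha : HasSign a r) (hb : HasSign b r) : a = b := by
  cases a <;> cases b <;> simp_all [HasSign] <;> linarith

theorem hasSign_decide {r : ℝ} (h : r ≠ 0) : HasSign (decide (0 < r)) r := by
  by_cases h0 : 0 < r
  · simp [HasSign, h0]
  · simp only [HasSign, h0, decide_false, Bool.false_eq_true, if_false]
    exact lt_of_le_of_ne (not_lt.1 h0) h

theorem isOpen_hasSign (b : Bool) : IsOpen {r : ℝ | HasSign b r} := by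
  cases b
  · exact isOpen_Iio (a := (0 : ℝ))
  · exact isOpen_Ioi (a := (0 : ℝ))

theorem convex_hasSign (b : Bool) : Convex ℝ {r : ℝ | HasSign b r} := by
  cases b
  · exact convex_Iio (𝕜 := ℝ) (0 : ℝ)
  · exact convex_Ioi (𝕜 := ℝ) (0 : ℝ)

theorem hasSign_of_isPreconnected {X : Type*} [TopologicalSpace X] {U : Set X} {f : X → ℝ}
    (hf : Continuous f) (hU : IsPreconnected U) (h0 : ∀ x ∈ U, f x ≠ 0) {b : Bool} {x y : X}
    (hx : x ∈ U) (hy : y ∈ U) (hb : HasSign b (f x)) : HasSign b (f y) := by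
  have hoc := (hU.image f hf.continuousOn).ordConnected
  have h0' : (0 : ℝ) ∉ f '' U := by
    rintro ⟨z, hz, hz0⟩
    exact h0 z hz hz0
  cases b
  · change f y < 0
    by_contra! h
    exact h0' (hoc.out (mem_image_of_mem f hx) (mem_image_of_mem f hy) ⟨le_of_lt hb, h⟩)
  · change 0 < f y
    by_contra! h
    exact h0' (hoc.out (mem_image_of_mem f hy) (mem_image_of_mem f hx) ⟨h, le_of_lt hb⟩)

/-- If `A` and `B` cross, they are the zero sets of continuous functions all four of whose sign
quadrants accumulate, and are locally connected, at every common point. -/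
theorem Crosses.exists_functions {A B : Set (Fin 3 → ℝ)} (h : Crosses A B) :
    ∃ f g : (Fin 3 → ℝ) → ℝ, Continuous f ∧ Continuous g ∧ A = {x | f x = 0} ∧
      B = {x | g x = 0} ∧
      (∀ x ∈ A, ∀ U ∈ 𝓝 x, ∀ a, ∃ y ∈ U, HasSign a (f y)) ∧
      (∀ x ∈ B, ∀ U ∈ 𝓝 x, ∀ b, ∃ y ∈ U, HasSign b (g y)) ∧
      (∀ x ∈ A ∩ B, ∀ U ∈ 𝓝 x, ∀ a b, ∃ y ∈ U, HasSign a (f y) ∧ HasSign b (g y)) ∧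
      ∀ x, ∀ U ∈ 𝓝 x, ∃ V ∈ 𝓝 x, V ⊆ U ∧
        ∀ a b, IsPreconnected {y ∈ V | HasSign a (f y) ∧ HasSign b (g y)} := by
  obtain ⟨e, hA, hB⟩ := h
  have hA' : A = {x | e x 0 = 0} := by
    ext x
    rw [← e.injective.mem_set_image, hA]
    simp [coordHyp]
  have hB' : B = {x | e x 1 = 0} := by
    ext x
    rw [← e.injective.mem_set_image, hB]
    simp [coordHyp]
  have key : ∀ x, ∀ U ∈ 𝓝 x, ∀ v : Fin 3 → ℝ,
      ∃ ε > (0 : ℝ), ∃ y ∈ U, e y = e x + ε • v := by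
    intro x U hU v
    have ht : Filter.Tendsto (fun ε : ℝ => e.symm (e x + ε • v)) (𝓝[>] 0) (𝓝 x) := by
      have : Continuous (fun ε : ℝ => e.symm (e x + ε • v)) := by fun_prop
      have := this.tendsto 0
      simp only [zero_smul, add_zero, Homeomorph.symm_apply_apply] at this
      exact this.mono_left nhdsWithin_le_nhds
    obtain ⟨ε, hε, hε'⟩ := ((ht.eventually hU).and self_mem_nhdsWithin).exists
    exact ⟨ε, hε', _, hε, by simp⟩
  have hsg : ∀ (a : Bool) (ε : ℝ), 0 < ε → HasSign a (ε * (if a then 1 else -1)) := by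
    intro a ε hε
    cases a <;> simp [HasSign, hε]
  refine ⟨fun x => e x 0, fun x => e x 1, by fun_prop, by fun_prop, hA', hB', ?_, ?_, ?_, ?_⟩
  · intro x hx U hU a
    rw [hA'] at hx
    obtain ⟨ε, hε, y, hy, hey⟩ := key x U hU ![if a then 1 else -1, 0, 0]
    refine ⟨y, hy, ?_⟩
    have h0 : e x 0 = 0 := hx
    simpa [hey, h0] using hsg a ε hε
  · intro x hx U hU a
    rw [hB'] at hx
    obtain ⟨ε, hε, y, hy, hey⟩ := key x U hU ![0, if a then 1 else -1, 0]
    refine ⟨y, hy, ?_⟩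
    have h0 : e x 1 = 0 := hx
    simpa [hey, h0] using hsg a ε hε
  · intro x hx U hU a b
    rw [hA', hB'] at hx
    obtain ⟨ε, hε, y, hy, hey⟩ := key x U hU ![if a then 1 else -1, if b then 1 else -1, 0]
    refine ⟨y, hy, ?_⟩
    have h0 : e x 0 = 0 := hx.1
    have h1 : e x 1 = 0 := hx.2
    exact ⟨by simpa [hey, h0] using hsg a ε hε, by simpa [hey, h1] using hsg b ε hε⟩
  · intro x U hU
    have hU' : e.symm ⁻¹' U ∈ 𝓝 (e x) := by
      refine e.symm.continuous.continuousAt.preimage_mem_nhds ?_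
      simpa using hU
    obtain ⟨r, hr, hball⟩ := Metric.mem_nhds_iff.1 hU'
    refine ⟨e ⁻¹' Metric.ball (e x) r, e.continuous.continuousAt.preimage_mem_nhds
      (Metric.ball_mem_nhds _ hr), fun y hy => by simpa using hball hy, fun a b => ?_⟩
    have hc : Convex ℝ (Metric.ball (e x) r ∩ ((fun v : Fin 3 → ℝ => v 0) ⁻¹' {r | HasSign a r} ∩
        (fun v : Fin 3 → ℝ => v 1) ⁻¹' {r | HasSign b r})) :=
      (convex_ball _ _).inter (((convex_hasSign a).linear_preimage
        (LinearMap.proj (R := ℝ) (φ := fun _ : Fin 3 => ℝ) 0)).inter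
        ((convex_hasSign b).linear_preimage
        (LinearMap.proj (R := ℝ) (φ := fun _ : Fin 3 => ℝ) 1)))
    have := hc.isPreconnected.image e.symm e.symm.continuous.continuousOn
    rw [e.symm.image_eq_preimage_symm] at this
    exact this

/-- Near `p`, the set `S` looks like `m` half-discs `F i` (the pages) glued along a common segment
of `S₁`; they separate the complement of `S` into the `m` wedges `W i`, where the page `F i` lies
between the wedges `W i` and `W (i + 1)`. -/
structure IsBook {m : ℕ} [NeZero m] (S S₁ : Set (Fin 3 → ℝ)) (p : Fin 3 → ℝ)
    (W F : Fin m → Set (Fin 3 → ℝ)) : Prop where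
  mem : p ∈ S₁
  isOpen_wedge : ∀ i, IsOpen (W i)
  isPreconnected_wedge : ∀ i, IsPreconnected (W i)
  wedge_subset : ∀ i, W i ⊆ Sᶜ
  disjoint_wedge : ∀ i j, i ≠ j → Disjoint (W i) (W j)
  mem_closure_wedge : ∀ i, p ∈ closure (W i)
  isPreconnected_page : ∀ i, IsPreconnected (F i)
  page_subset : ∀ i, F i ⊆ S \ S₁
  mem_closure_page : ∀ i, p ∈ closure (F i)
  isOpen_union : ∀ i, IsOpen (W i ∪ F i ∪ W (i + 1))
  isPreconnected_union : ∀ i, IsPreconnected (W i ∪ F i ∪ W (i + 1))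
  nhds : (⋃ i, W i) ∪ ⋃ i, closure (F i) ∈ 𝓝 p

/-- A family of topoplanes covering `S` whose pairwise intersections cover `S₁`, and in which
intersecting members cross. -/
structure IsCrossingFamily (𝓗 : Set (Set (Fin 3 → ℝ))) (S S₁ : Set (Fin 3 → ℝ)) : Prop where
  finite : 𝓗.Finite
  isClosed : ∀ T ∈ 𝓗, IsClosed T
  sUnion : ⋃₀ 𝓗 = S
  dense : Dense Sᶜ
  inter_subset : ∀ A ∈ 𝓗, ∀ B ∈ 𝓗, A ≠ B → A ∩ B ⊆ S₁
  exists_two : ∀ p ∈ S₁, ∃ A ∈ 𝓗, ∃ B ∈ 𝓗, A ≠ B ∧ p ∈ A ∧ p ∈ B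
  crosses : ∀ A ∈ 𝓗, ∀ B ∈ 𝓗, A ≠ B → (A ∩ B).Nonempty → Crosses A B

namespace IsCrossingFamily

variable {𝓗 : Set (Set (Fin 3 → ℝ))} {S S₁ : Set (Fin 3 → ℝ)}

theorem isClosed_union (h : IsCrossingFamily 𝓗 S S₁) : IsClosed S := by
  rw [← h.sUnion, sUnion_eq_biUnion]
  exact h.finite.isClosed_biUnion h.isClosed

theorem exists_ne (h : IsCrossingFamily 𝓗 S S₁) {p : Fin 3 → ℝ} (hp : p ∈ S₁)
    (A : Set (Fin 3 → ℝ)) : ∃ B ∈ 𝓗, B ≠ A ∧ p ∈ B := by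
  obtain ⟨B, hB, C, hC, hBC, hpB, hpC⟩ := h.exists_two p hp
  by_cases hBA : B = A
  · exact ⟨C, hC, fun hCA => hBC (hBA.trans hCA.symm), hpC⟩
  · exact ⟨B, hB, hBA, hpB⟩

theorem eq_of_subset (h : IsCrossingFamily 𝓗 S S₁) {F A B : Set (Fin 3 → ℝ)}
    (hne : F.Nonempty) (hF : F ⊆ S \ S₁) (hA : A ∈ 𝓗) (hB : B ∈ 𝓗) (hFA : F ⊆ A) (hFB : F ⊆ B) :
    A = B := by
  by_contra hAB
  obtain ⟨x, hx⟩ := hne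
  exact (hF hx).2 (h.inter_subset A hA B hB hAB ⟨hFA hx, hFB hx⟩)

theorem subset_of_inter_nonempty (h : IsCrossingFamily 𝓗 S S₁) {F A : Set (Fin 3 → ℝ)}
    (hF : F ⊆ S \ S₁) (hpre : IsPreconnected F) (hA : A ∈ 𝓗) (hne : (F ∩ A).Nonempty) :
    F ⊆ A := by
  have hcl : IsClosed (⋃₀ (𝓗 \ {A})) := by
    rw [sUnion_eq_biUnion]
    exact (h.finite.subset sdiff_subset).isClosed_biUnion fun T hT => h.isClosed T hT.1
  have hcov : F ⊆ A ∪ ⋃₀ (𝓗 \ {A}) := by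
    intro x hx
    have hxS := (hF hx).1
    rw [← h.sUnion] at hxS
    obtain ⟨T, hT, hxT⟩ := hxS
    by_cases hTA : T = A
    · exact Or.inl (hTA ▸ hxT)
    · exact Or.inr ⟨T, ⟨hT, hTA⟩, hxT⟩
  have hdis : F ∩ (A ∩ ⋃₀ (𝓗 \ {A})) = ∅ := by
    rw [eq_empty_iff_forall_notMem]
    rintro x ⟨hx, hxA, T, ⟨hT, hTA⟩, hxT⟩
    exact (hF hx).2 (h.inter_subset T hT A hA hTA ⟨hxT, hxA⟩)
  rcases isPreconnected_iff_subset_of_disjoint_closed.1 hpre A _ (h.isClosed A hA) hcl hcov hdis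
    with h1 | h1
  · exact h1
  · obtain ⟨x, hx, hxA⟩ := hne
    have : x ∈ F ∩ (A ∩ ⋃₀ (𝓗 \ {A})) := ⟨hx, hxA, h1 hx⟩
    rw [hdis] at this
    exact this.elim

theorem exists_subset (h : IsCrossingFamily 𝓗 S S₁) {F : Set (Fin 3 → ℝ)} (hne : F.Nonempty)
    (hF : F ⊆ S \ S₁) (hpre : IsPreconnected F) : ∃ A ∈ 𝓗, F ⊆ A := by
  obtain ⟨x, hx⟩ := hne
  have hxS := (hF hx).1
  rw [← h.sUnion] at hxS
  obtain ⟨T, hT, hxT⟩ := hxS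
  exact ⟨T, hT, h.subset_of_inter_nonempty hF hpre hT ⟨x, hx, hxT⟩⟩

variable {m : ℕ} [NeZero m] {p : Fin 3 → ℝ} {W F : Fin m → Set (Fin 3 → ℝ)}

theorem _root_.IsBook.page_nonempty (hb : IsBook S S₁ p W F) (i : Fin m) : (F i).Nonempty :=
  closure_nonempty_iff.1 ⟨p, hb.mem_closure_page i⟩

theorem _root_.IsBook.wedge_nonempty (hb : IsBook S S₁ p W F) (i : Fin m) : (W i).Nonempty :=
  closure_nonempty_iff.1 ⟨p, hb.mem_closure_wedge i⟩

theorem mem_of_page_subset (h : IsCrossingFamily 𝓗 S S₁) (hb : IsBook S S₁ p W F)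
    {A : Set (Fin 3 → ℝ)} (hA : A ∈ 𝓗) {i : Fin m} (hi : F i ⊆ A) : p ∈ A :=
  closure_minimal hi (h.isClosed A hA) (hb.mem_closure_page i)

/-- A member of the family contains exactly the pages at which the sign of its defining function
changes. -/
theorem exists_signs (h : IsCrossingFamily 𝓗 S S₁) (hb : IsBook S S₁ p W F)
    {A : Set (Fin 3 → ℝ)} (hA : A ∈ 𝓗) {f : (Fin 3 → ℝ) → ℝ} (hf : Continuous f)
    (hAf : A = {x | f x = 0}) (hsign : ∀ x ∈ A, ∀ U ∈ 𝓝 x, ∀ a, ∃ y ∈ U, HasSign a (f y)) :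
    ∃ s : Fin m → Bool, (∀ i, ∀ y ∈ W i, HasSign (s i) (f y)) ∧
      ∀ i, F i ⊆ A ↔ s i ≠ s (i + 1) := by
  choose w hw using hb.wedge_nonempty
  have hAS : A ⊆ S := by
    rw [← h.sUnion]
    exact subset_sUnion_of_mem hA
  have hW0 : ∀ i, ∀ y ∈ W i, f y ≠ 0 := by
    intro i y hy h0
    exact hb.wedge_subset i hy (hAS (by rw [hAf]; exact h0))
  have hs : ∀ i, ∀ y ∈ W i, HasSign (decide (0 < f (w i))) (f y) := fun i y hy =>
    hasSign_of_isPreconnected hf (hb.isPreconnected_wedge i) (hW0 i) (hw i) hy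
      (hasSign_decide (hW0 i _ (hw i)))
  refine ⟨fun i => decide (0 < f (w i)), hs, fun i => ⟨fun hi heq => ?_, fun hne => ?_⟩⟩
  · obtain ⟨q, hq⟩ := hb.page_nonempty i
    obtain ⟨y, hy, hys⟩ := hsign q (hi hq) _ ((hb.isOpen_union i).mem_nhds (Or.inl (Or.inr hq)))
      (!decide (0 < f (w i)))
    rcases hy with (hy | hy) | hy
    · simpa using (hs i y hy).unique hys
    · have hyA := hi hy
      rw [hAf] at hyA
      exact hys.ne_zero hyA
    · have := (hs (i + 1) y hy).unique hys
      have heq' : decide (0 < f (w i)) = decide (0 < f (w (i + 1))) := heq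
      rw [← heq'] at this
      simp at this
  · refine h.subset_of_inter_nonempty (hb.page_subset i) (hb.isPreconnected_page i) hA ?_
    by_contra hemp
    refine hne ((hs i _ (hw i)).unique (hasSign_of_isPreconnected hf (hb.isPreconnected_union i)
      ?_ (Or.inr (hw (i + 1))) (Or.inl (Or.inl (hw i))) (hs (i + 1) _ (hw (i + 1)))))
    rintro y ((hy | hy) | hy) h0
    · exact hW0 i y hy h0
    · exact hemp ⟨y, hy, by rw [hAf]; exact h0⟩
    · exact hW0 _ y hy h0

theorem exists_signs_pair (h : IsCrossingFamily 𝓗 S S₁) (hb : IsBook S S₁ p W F)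
    {A B : Set (Fin 3 → ℝ)} (hA : A ∈ 𝓗) (hB : B ∈ 𝓗) (hAB : A ≠ B) (hpA : p ∈ A) (hpB : p ∈ B) :
    ∃ s t : Fin m → Bool, (∀ i, F i ⊆ A ↔ s i ≠ s (i + 1)) ∧ (∀ i, F i ⊆ B ↔ t i ≠ t (i + 1)) ∧
      (∀ a b, ∃ i, s i = a ∧ t i = b) ∧
      ((∀ i, F i ⊆ A ∨ F i ⊆ B) → ∀ i j, s i = s j → t i = t j → i = j) := by
  obtain ⟨f, g, hf, hg, hAf, hBg, hsA, hsB, hsAB, hloc⟩ :=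
    (h.crosses A hA B hB hAB ⟨p, hpA, hpB⟩).exists_functions
  obtain ⟨s, hs, hsF⟩ := h.exists_signs hb hA hf hAf hsA
  obtain ⟨t, ht, htF⟩ := h.exists_signs hb hB hg hBg hsB
  refine ⟨s, t, hsF, htF, fun a b => ?_, fun hall i j hsij htij => ?_⟩
  · obtain ⟨y, hyN, hya, hyb⟩ := hsAB p ⟨hpA, hpB⟩ _ (interior_mem_nhds.2 hb.nhds) a b
    have hopen : IsOpen (interior ((⋃ i, W i) ∪ ⋃ i, closure (F i)) ∩
        (f ⁻¹' {r | HasSign a r} ∩ g ⁻¹' {r | HasSign b r})) :=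
      isOpen_interior.inter (((isOpen_hasSign a).preimage hf).inter
        ((isOpen_hasSign b).preimage hg))
    obtain ⟨z, ⟨hzN, hza, hzb⟩, hzS⟩ := h.dense.inter_open_nonempty _ hopen ⟨y, hyN, hya, hyb⟩
    rcases interior_subset hzN with hz | hz
    · obtain ⟨i, hi⟩ := mem_iUnion.1 hz
      exact ⟨i, (hs i z hi).unique hza, (ht i z hi).unique hzb⟩
    · obtain ⟨i, hi⟩ := mem_iUnion.1 hz
      exact (hzS (closure_minimal (fun x hx => (hb.page_subset i hx).1) h.isClosed_union hi)).elim
  · by_contra hij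
    obtain ⟨V, hV, hVN, hVpre⟩ := hloc p _ hb.nhds
    have hmeet : ∀ k, s k = s i → t k = t i →
        ({y ∈ V | HasSign (s i) (f y) ∧ HasSign (t i) (g y)} ∩ W k).Nonempty := by
      intro k hk1 hk2
      obtain ⟨y, hyV, hyW⟩ := mem_closure_iff_nhds.1 (hb.mem_closure_wedge k) V hV
      exact ⟨y, ⟨hyV, hk1 ▸ hs k y hyW, hk2 ▸ ht k y hyW⟩, hyW⟩
    have hcov : {y ∈ V | HasSign (s i) (f y) ∧ HasSign (t i) (g y)} ⊆
        W i ∪ ⋃ k ∈ {k | k ≠ i}, W k := by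
      rintro y ⟨hyV, hyf, hyg⟩
      rcases hVN hyV with hy | hy
      · obtain ⟨k, hk⟩ := mem_iUnion.1 hy
        by_cases hki : k = i
        · exact Or.inl (hki ▸ hk)
        · exact Or.inr (mem_biUnion (show k ∈ {k | k ≠ i} from hki) hk)
      · obtain ⟨k, hk⟩ := mem_iUnion.1 hy
        rcases hall k with hkA | hkB
        · have hyA := closure_minimal hkA (h.isClosed A hA) hk
          rw [hAf] at hyA
          exact (hyf.ne_zero hyA).elim
        · have hyB := closure_minimal hkB (h.isClosed B hB) hk
          rw [hBg] at hyB
          exact (hyg.ne_zero hyB).elim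
    obtain ⟨y, hy1, hyj⟩ := hmeet j hsij.symm htij.symm
    obtain ⟨z, -, hz1, hz2⟩ := hVpre (s i) (t i) _ _ (hb.isOpen_wedge i)
      (isOpen_biUnion fun k _ => hb.isOpen_wedge k) hcov (hmeet i rfl rfl)
      ⟨y, hy1, mem_biUnion (show j ∈ {k | k ≠ i} from Ne.symm hij) hyj⟩
    obtain ⟨k, hk, hzk⟩ := mem_iUnion₂.1 hz2
    exact disjoint_left.1 (hb.disjoint_wedge k i hk) hzk hz1

theorem exists_page_subset (h : IsCrossingFamily 𝓗 S S₁) (hb : IsBook S S₁ p W F)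
    {A : Set (Fin 3 → ℝ)} (hA : A ∈ 𝓗) (hpA : p ∈ A) : ∃ i, F i ⊆ A := by
  obtain ⟨B, hB, hBA, hpB⟩ := h.exists_ne hb.mem A
  obtain ⟨s, t, hs, -, hst, -⟩ := h.exists_signs_pair hb hA hB hBA.symm hpA hpB
  by_contra! hno
  have hconst : ∀ n : ℕ, s (Fin.ofNat m n) = s 0 := by
    intro n
    induction n with
    | zero => rfl
    | succ n ih =>
      have := (hs (Fin.ofNat m n)).not.1 (hno _)
      rw [not_not] at this
      rw [← ih, this]
      congr 1
      ext
      simp [Fin.val_add]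
  obtain ⟨i, hi, -⟩ := hst (!s 0) true
  have := hconst i
  rw [show Fin.ofNat m i = i by ext; simp, hi] at this
  simp at this

end IsCrossingFamily

set_option synthInstance.maxHeartbeats 400000 in
set_option synthInstance.maxSize 4000 in
theorem sign_changes_four (s t : Fin 4 → Bool)
    (hdis : ∀ i, s i ≠ s (i + 1) → ¬ t i ≠ t (i + 1)) (hst : ∀ a b, ∃ i, s i = a ∧ t i = b)
    (i j : Fin 4) (hi : s i ≠ s (i + 1)) : s j ≠ s (j + 1) ↔ j = i ∨ j = i + 2 := by
  revert s t i j
  decide +kernel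

theorem eq_or_eq_not_of_sign_changes (s t : Fin 6 → Bool)
    (h : ∀ i, s i ≠ s (i + 1) ↔ t i ≠ t (i + 1)) : s = t ∨ s = fun i => !t i := by
  revert s t
  decide +kernel

set_option synthInstance.maxHeartbeats 400000 in
set_option synthInstance.maxSize 4000 in
theorem sign_changes_six (s t u : Fin 6 → Bool)
    (hst' : ∀ i, s i ≠ s (i + 1) → ¬ t i ≠ t (i + 1))
    (hst : ∀ a b, ∃ i, s i = a ∧ t i = b)
    (hsu' : ∀ i, s i ≠ s (i + 1) → ¬ u i ≠ u (i + 1))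
    (htu' : ∀ i, t i ≠ t (i + 1) → ¬ u i ≠ u (i + 1))
    (hsu : ∀ a b, ∃ i, s i = a ∧ u i = b) (htu : ∀ a b, ∃ i, t i = a ∧ u i = b)
    (i j : Fin 6) (hi : s i ≠ s (i + 1)) : s j ≠ s (j + 1) ↔ j = i ∨ j = i + 3 := by
  have key : ∀ s t : Fin 6 → Bool, (∀ i, s i ≠ s (i + 1) → ¬ t i ≠ t (i + 1)) →
    (∀ a b, ∃ i, s i = a ∧ t i = b) →
    ∀ u : Fin 6 → Bool, (∀ i, s i ≠ s (i + 1) → ¬ u i ≠ u (i + 1)) →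
    (∀ i, t i ≠ t (i + 1) → ¬ u i ≠ u (i + 1)) →
    (∀ a b, ∃ i, s i = a ∧ u i = b) → (∀ a b, ∃ i, t i = a ∧ u i = b) →
    ∀ i j : Fin 6, s i ≠ s (i + 1) → (s j ≠ s (j + 1) ↔ j = i ∨ j = i + 3) := by
    decide +kernel
  exact key s t hst' hst u hsu' htu' hsu htu i j hi

namespace IsCrossingFamily

variable {𝓗 : Set (Set (Fin 3 → ℝ))} {S S₁ : Set (Fin 3 → ℝ)} {p : Fin 3 → ℝ}

theorem page_subset_iff_four (h : IsCrossingFamily 𝓗 S S₁) {W F : Fin 4 → Set (Fin 3 → ℝ)}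
    (hb : IsBook S S₁ p W F) {A : Set (Fin 3 → ℝ)} (hA : A ∈ 𝓗) {i : Fin 4} (hi : F i ⊆ A)
    (j : Fin 4) : F j ⊆ A ↔ j = i ∨ j = i + 2 := by
  obtain ⟨B, hB, hBA, hpB⟩ := h.exists_ne hb.mem A
  obtain ⟨s, t, hs, ht, hst, -⟩ :=
    h.exists_signs_pair hb hA hB hBA.symm (h.mem_of_page_subset hb hA hi) hpB
  rw [hs j]
  refine sign_changes_four s t (fun k hk hk' => hBA.symm ?_) hst i j ((hs i).1 hi)
  exact h.eq_of_subset (hb.page_nonempty k) (hb.page_subset k) hA hB ((hs k).2 hk) ((ht k).2 hk')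

theorem page_subset_iff_six (h : IsCrossingFamily 𝓗 S S₁) {W F : Fin 6 → Set (Fin 3 → ℝ)}
    (hb : IsBook S S₁ p W F) {A : Set (Fin 3 → ℝ)} (hA : A ∈ 𝓗) {i : Fin 6} (hi : F i ⊆ A)
    (j : Fin 6) : F j ⊆ A ↔ j = i ∨ j = i + 3 := by
  obtain ⟨B, hB, hBA, hpB⟩ := h.exists_ne hb.mem A
  have hpA := h.mem_of_page_subset hb hA hi
  obtain ⟨s, t, hs, ht, hst, hinj⟩ := h.exists_signs_pair hb hA hB hBA.symm hpA hpB
  obtain ⟨k, hkA, hkB⟩ : ∃ k, ¬ F k ⊆ A ∧ ¬ F k ⊆ B := by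
    by_contra! hno
    have hcard := Fintype.card_le_of_injective (fun k => (s k, t k)) fun a b hab => by
      simp only [Prod.mk.injEq] at hab
      exact hinj (fun k => or_iff_not_imp_left.2 (hno k)) a b hab.1 hab.2
    simp at hcard
  obtain ⟨C, hC, hkC⟩ := h.exists_subset (hb.page_nonempty k) (hb.page_subset k)
    (hb.isPreconnected_page k)
  have hCA : A ≠ C := fun hh => hkA (hh ▸ hkC)
  have hCB : B ≠ C := fun hh => hkB (hh ▸ hkC)
  have hpC := h.mem_of_page_subset hb hC hkC
  obtain ⟨s', u, hs', hu, hsu, -⟩ := h.exists_signs_pair hb hA hC hCA hpA hpC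
  obtain ⟨t', u', ht', hu', htu, -⟩ := h.exists_signs_pair hb hB hC hCB hpB hpC
  have hflip : ∀ {v v' : Fin 6 → Bool}, (∀ i, v i ≠ v (i + 1) ↔ v' i ≠ v' (i + 1)) →
      ∀ a, ∃ a', ∀ i, v' i = a' → v i = a := by
    intro v v' hv a
    rcases eq_or_eq_not_of_sign_changes v v' hv with rfl | rfl
    · exact ⟨a, fun i hi => hi⟩
    · exact ⟨!a, fun i hi => by simp [hi]⟩
  have hsep : ∀ {X Y : Set (Fin 3 → ℝ)}, X ∈ 𝓗 → Y ∈ 𝓗 → X ≠ Y → ∀ k, F k ⊆ X → ¬ F k ⊆ Y :=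
    fun hX hY hXY k hkX hkY =>
      hXY (h.eq_of_subset (hb.page_nonempty k) (hb.page_subset k) hX hY hkX hkY)
  rw [hs j]
  refine sign_changes_six s t u (fun k => ?_) hst (fun k => ?_) (fun k => ?_) (fun a b => ?_)
    (fun a b => ?_) i j ((hs i).1 hi)
  · rw [← hs, ← ht]
    exact hsep hA hB hBA.symm k
  · rw [← hs, ← hu]
    exact hsep hA hC hCA k
  · rw [← ht, ← hu]
    exact hsep hB hC hCB k
  · obtain ⟨a', ha'⟩ := hflip (fun i => (hs i).symm.trans (hs' i)) a
    obtain ⟨k, hk1, hk2⟩ := hsu a' b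
    exact ⟨k, ha' k hk1, hk2⟩
  · obtain ⟨a', ha'⟩ := hflip (fun i => (ht i).symm.trans (ht' i)) a
    obtain ⟨b', hb'⟩ := hflip (fun i => (hu i).symm.trans (hu' i)) b
    obtain ⟨k, hk1, hk2⟩ := htu a' b'
    exact ⟨k, ha' k hk1, hb' k hk2⟩

end IsCrossingFamily

/-- The value at `x` of the linear functional with coefficients `c`. -/
def evalRow (c x : Fin 3 → ℝ) : ℝ := c 0 * x 0 + c 1 * x 1 + c 2 * x 2

/-- The relatively open polyhedral cone cut out by linear equations `E` and strict
inequalities `I`. -/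
def polyCone (E I : List (Fin 3 → ℝ)) : Set (Fin 3 → ℝ) :=
  {x | (∀ c ∈ E, evalRow c x = 0) ∧ ∀ c ∈ I, 0 < evalRow c x}

theorem evalRow_combo (c x y : Fin 3 → ℝ) (a b : ℝ) :
    evalRow c (a • x + b • y) = a * evalRow c x + b * evalRow c y := by
  simp only [evalRow, Pi.add_apply, Pi.smul_apply, smul_eq_mul]
  ring

theorem convex_polyCone (E I : List (Fin 3 → ℝ)) : Convex ℝ (polyCone E I) := by
  intro x hx y hy a b ha hb hab
  refine ⟨fun c hc => ?_, fun c hc => ?_⟩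
  · rw [evalRow_combo, hx.1 c hc, hy.1 c hc]
    ring
  · rw [evalRow_combo]
    have h1 := hx.2 c hc
    have h2 := hy.2 c hc
    rcases ha.eq_or_lt with rfl | ha
    · rw [zero_add] at hab
      simpa [hab] using h2
    · positivity

theorem isOpen_polyCone (I : List (Fin 3 → ℝ)) : IsOpen (polyCone [] I) := by
  have : polyCone [] I = ⋂ c ∈ {c | c ∈ I}, {x | 0 < evalRow c x} := by
    ext x
    simp [polyCone]
  rw [this]
  refine (List.finite_toSet I).isOpen_biInter fun c _ => isOpen_lt continuous_const ?_
  unfold evalRow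
  fun_prop

theorem mem_closure_polyCone {E I : List (Fin 3 → ℝ)} {p q : Fin 3 → ℝ} (hq : q ∈ polyCone E I)
    (hE : ∀ c ∈ E, evalRow c p = 0) (hI : ∀ c ∈ I, 0 ≤ evalRow c p) :
    p ∈ closure (polyCone E I) := by
  have ht : Filter.Tendsto (fun ε : ℝ => (1 : ℝ) • p + ε • q) (𝓝[>] 0) (𝓝 p) := by
    have : Continuous (fun ε : ℝ => (1 : ℝ) • p + ε • q) := by fun_prop
    have := this.tendsto 0
    simp only [zero_smul, add_zero, one_smul] at this ⊢
    exact this.mono_left nhdsWithin_le_nhds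
  refine mem_closure_of_tendsto ht ?_
  filter_upwards [self_mem_nhdsWithin] with ε hε
  have hε : 0 < ε := hε
  refine ⟨fun c hc => ?_, fun c hc => ?_⟩
  · rw [evalRow_combo, hE c hc, hq.1 c hc]
    ring
  · rw [evalRow_combo]
    have h1 := hI c hc
    have h2 := hq.2 c hc
    positivity

/-- A criterion for a book all of whose wedges and pages are polyhedral cones. -/
theorem IsBook.of_polyCone {m : ℕ} [NeZero m] {S S₁ : Set (Fin 3 → ℝ)} {p : Fin 3 → ℝ}
    (w e f v : Fin m → List (Fin 3 → ℝ)) (N : List (Fin 3 → ℝ)) (a b : Fin m → Fin 3 → ℝ)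
    (hp : p ∈ S₁)
    (hw : ∀ i x, x ∈ polyCone [] (w i) → x ∉ S)
    (hww : ∀ i j, i ≠ j → ∀ x, x ∈ polyCone [] (w i) → x ∉ polyCone [] (w j))
    (ha : ∀ i, a i ∈ polyCone [] (w i)) (hwp : ∀ i, ∀ c ∈ w i, 0 ≤ evalRow c p)
    (hf : ∀ i x, x ∈ polyCone (e i) (f i) → x ∈ S ∧ x ∉ S₁)
    (hb : ∀ i, b i ∈ polyCone (e i) (f i))
    (hep : ∀ i, ∀ c ∈ e i, evalRow c p = 0) (hfp : ∀ i, ∀ c ∈ f i, 0 ≤ evalRow c p)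
    (hv : ∀ i x, (x ∈ polyCone [] (w i) ∨ x ∈ polyCone (e i) (f i)) ∨ x ∈ polyCone [] (w (i + 1)) ↔
      x ∈ polyCone [] (v i))
    (hpN : p ∈ polyCone [] N)
    (hN : ∀ x ∈ polyCone [] N, (∃ i, x ∈ polyCone [] (w i)) ∨
      ∃ i, (∀ c ∈ e i, evalRow c x = 0) ∧ ∀ c ∈ f i, 0 ≤ evalRow c x) :
    IsBook S S₁ p (fun i => polyCone [] (w i)) (fun i => polyCone (e i) (f i)) := by
  have hV : ∀ i, polyCone [] (w i) ∪ polyCone (e i) (f i) ∪ polyCone [] (w (i + 1)) =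
      polyCone [] (v i) := fun i => ext (hv i)
  refine ⟨hp, fun i => isOpen_polyCone _, fun i => (convex_polyCone _ _).isPreconnected,
    fun i x hx => hw i x hx, fun i j hij => disjoint_left.2 (hww i j hij),
    fun i => mem_closure_polyCone (ha i) (by simp) (hwp i),
    fun i => (convex_polyCone _ _).isPreconnected, fun i x hx => hf i x hx,
    fun i => mem_closure_polyCone (hb i) (hep i) (hfp i),
    fun i => ?_, fun i => ?_, ?_⟩
  · rw [hV]
    exact isOpen_polyCone _
  · rw [hV]
    exact (convex_polyCone _ _).isPreconnected
  · refine Filter.mem_of_superset ((isOpen_polyCone N).mem_nhds hpN) fun x hx => ?_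
    rcases hN x hx with ⟨i, hi⟩ | ⟨i, h1, h2⟩
    · exact Or.inl (mem_iUnion.2 ⟨i, hi⟩)
    · exact Or.inr (mem_iUnion.2 ⟨i, mem_closure_polyCone (hb i) h1 h2⟩)

/-- The union of the five topoplanes of the arrangement. -/
def fiveUnion : Set (Fin 3 → ℝ) :=
  {x | x 0 = 0 ∨ x 1 = 0 ∨ x 1 = |x 0| ∨ x 2 = 0 ∨ x 1 + x 2 = 0}

/-- The set of points lying on at least two of the five topoplanes. -/
def fiveLines : Set (Fin 3 → ℝ) :=
  {x | x 0 = 0 ∧ x 1 = 0 ∨ x 0 = 0 ∧ x 2 = 0 ∨ x 0 = 0 ∧ x 1 + x 2 = 0 ∨ x 1 = 0 ∧ x 2 = 0 ∨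
    x 1 = |x 0| ∧ x 2 = 0 ∨ x 1 = |x 0| ∧ x 1 + x 2 = 0}

set_option maxHeartbeats 2000000 in
theorem isBook_pos_z :
    IsBook fiveUnion fiveLines ![0, 0, 1]
      (fun i : Fin 6 => polyCone [] (![[![1, 0, 0], ![0, -1, 0], ![0, 0, 1], ![0, 1, 1]],
        [![0, 1, 0], ![1, -1, 0], ![0, 0, 1], ![0, 1, 1]],
        [![1, 0, 0], ![-1, 1, 0], ![0, 0, 1], ![0, 1, 1]],
        [![-1, 0, 0], ![1, 1, 0], ![0, 0, 1], ![0, 1, 1]],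
        [![0, 1, 0], ![-1, -1, 0], ![0, 0, 1], ![0, 1, 1]],
        [![-1, 0, 0], ![0, -1, 0], ![0, 0, 1], ![0, 1, 1]]] i))
      (fun i : Fin 6 => polyCone (![[![0, 1, 0]],
        [![-1, 1, 0]],
        [![1, 0, 0]],
        [![1, 1, 0]],
        [![0, 1, 0]],
        [![1, 0, 0]]] i)
        (![[![1, 0, 0], ![0, 0, 1], ![0, 1, 1]],
        [![1, 0, 0], ![0, 0, 1], ![0, 1, 1]],
        [![0, 1, 0], ![0, 0, 1], ![0, 1, 1]],
        [![-1, 0, 0], ![0, 0, 1], ![0, 1, 1]],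
        [![-1, 0, 0], ![0, 0, 1], ![0, 1, 1]],
        [![0, -1, 0], ![0, 0, 1], ![0, 1, 1]]] i)) := by
  refine IsBook.of_polyCone _ _ _
    ![[![1, 0, 0], ![1, -1, 0], ![0, 0, 1], ![0, 1, 1]],
      [![1, 0, 0], ![0, 1, 0], ![0, 0, 1], ![0, 1, 1]],
      [![-1, 1, 0], ![1, 1, 0], ![0, 0, 1], ![0, 1, 1]],
      [![-1, 0, 0], ![0, 1, 0], ![0, 0, 1], ![0, 1, 1]],
      [![-1, 0, 0], ![-1, -1, 0], ![0, 0, 1], ![0, 1, 1]],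
      [![0, -1, 0], ![0, 0, 1], ![0, 1, 1]]]
    [![0, 0, 1], ![0, 1, 1]]
    ![![1, -1, 2],
      ![2, 1, 1],
      ![1, 2, 1],
      ![-1, 2, 1],
      ![-2, 1, 1],
      ![-1, -1, 2]]
    ![![1, 0, 1],
      ![1, 1, 1],
      ![0, 1, 1],
      ![-1, 1, 1],
      ![-1, 0, 1],
      ![0, -1, 2]]
    ?_ ?_ ?_ ?_ ?_ ?_ ?_ ?_ ?_ ?_ ?_ ?_
  · simp [fiveLines]
  · intro i x hx hS
    fin_cases i <;> simp [polyCone, evalRow, fiveUnion] at hx hS <;>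
      rcases abs_cases (x 0) with ⟨h, _⟩ | ⟨h, _⟩ <;> rw [h] at hS <;> grind
  · intro i j hij x hx hx'
    fin_cases i <;> fin_cases j <;> simp [polyCone, evalRow] at hx hx' hij <;> linarith
  · intro i
    fin_cases i <;> simp [polyCone, evalRow] <;> norm_num
  · intro i
    fin_cases i <;> simp [evalRow]
  · intro i x hx
    fin_cases i <;> simp [polyCone, evalRow, fiveUnion, fiveLines] at hx ⊢ <;>
      rcases abs_cases (x 0) with ⟨h, _⟩ | ⟨h, _⟩ <;> simp only [h] <;> grind
  · intro i
    fin_cases i <;> simp [polyCone, evalRow]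
  · intro i
    fin_cases i <;> simp [evalRow]
  · intro i
    fin_cases i <;> simp [evalRow]
  · intro i x
    fin_cases i <;> simp [polyCone, evalRow] <;> grind
  · simp [polyCone, evalRow]
  · intro x hx
    simp [polyCone, evalRow, Fin.exists_fin_succ] at hx ⊢
    grind

set_option maxHeartbeats 2000000 in
theorem isBook_x {s : ℝ} (hs : s = 1 ∨ s = -1) :
    IsBook fiveUnion fiveLines ![s, 0, 0]
      (fun i : Fin 6 => polyCone [] (![[![0, 1, 1], ![0, 0, -1], ![s, 0, 0], ![s, -1, 0]],
        [![0, 1, 0], ![0, 0, 1], ![s, 0, 0], ![s, -1, 0]],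
        [![0, -1, 0], ![0, 1, 1], ![s, 0, 0], ![s, -1, 0]],
        [![0, 0, 1], ![0, -1, -1], ![s, 0, 0], ![s, -1, 0]],
        [![0, 0, -1], ![0, -1, 0], ![s, 0, 0], ![s, -1, 0]],
        [![0, 1, 0], ![0, -1, -1], ![s, 0, 0], ![s, -1, 0]]] i))
      (fun i : Fin 6 => polyCone (![[![0, 0, 1]],
        [![0, 1, 0]],
        [![0, 1, 1]],
        [![0, 0, 1]],
        [![0, 1, 0]],
        [![0, 1, 1]]] i)
        (![[![0, 1, 0], ![s, 0, 0], ![s, -1, 0]],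
        [![0, 0, 1], ![s, 0, 0], ![s, -1, 0]],
        [![0, -1, 0], ![s, 0, 0], ![s, -1, 0]],
        [![0, -1, 0], ![s, 0, 0], ![s, -1, 0]],
        [![0, 0, -1], ![s, 0, 0], ![s, -1, 0]],
        [![0, 1, 0], ![s, 0, 0], ![s, -1, 0]]] i)) := by
  refine IsBook.of_polyCone _ _ _
    ![[![0, 1, 0], ![0, 1, 1], ![s, 0, 0], ![s, -1, 0]],
      [![0, 0, 1], ![0, 1, 1], ![s, 0, 0], ![s, -1, 0]],
      [![0, -1, 0], ![0, 0, 1], ![s, 0, 0], ![s, -1, 0]],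
      [![0, -1, 0], ![0, -1, -1], ![s, 0, 0], ![s, -1, 0]],
      [![0, 0, -1], ![0, -1, -1], ![s, 0, 0], ![s, -1, 0]],
      [![0, 1, 0], ![0, 0, -1], ![s, 0, 0], ![s, -1, 0]]]
    [![s, 0, 0], ![s, -1, 0]]
    ![![3 * s, 2, -1],
      ![2 * s, 1, 1],
      ![s, -1, 2],
      ![s, -2, 1],
      ![s, -1, -1],
      ![2 * s, 1, -2]]
    ![![2 * s, 1, 0],
      ![s, 0, 1],
      ![s, -1, 1],
      ![s, -1, 0],
      ![s, 0, -1],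
      ![2 * s, 1, -1]]
    ?_ ?_ ?_ ?_ ?_ ?_ ?_ ?_ ?_ ?_ ?_ ?_
  · rcases hs with rfl | rfl <;>
      simp [fiveLines]
  · intro i x hx hS
    rcases hs with rfl | rfl <;>
      fin_cases i <;> simp [polyCone, evalRow, fiveUnion] at hx hS <;>
      rcases abs_cases (x 0) with ⟨h, _⟩ | ⟨h, _⟩ <;> rw [h] at hS <;> grind
  · intro i j hij x hx hx'
    rcases hs with rfl | rfl <;>
      fin_cases i <;> fin_cases j <;> simp [polyCone, evalRow] at hx hx' hij <;> linarith
  · intro i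
    rcases hs with rfl | rfl <;>
      fin_cases i <;> simp [polyCone, evalRow] <;> norm_num
  · intro i
    rcases hs with rfl | rfl <;>
      fin_cases i <;> simp [evalRow]
  · intro i x hx
    rcases hs with rfl | rfl <;>
      fin_cases i <;> simp [polyCone, evalRow, fiveUnion, fiveLines] at hx ⊢ <;>
      rcases abs_cases (x 0) with ⟨h, _⟩ | ⟨h, _⟩ <;> simp only [h] <;> grind
  · intro i
    rcases hs with rfl | rfl <;>
      fin_cases i <;> simp [polyCone, evalRow]
  · intro i
    rcases hs with rfl | rfl <;>
      fin_cases i <;> simp [evalRow]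
  · intro i
    rcases hs with rfl | rfl <;>
      fin_cases i <;> simp [evalRow]
  · intro i x
    rcases hs with rfl | rfl <;>
      fin_cases i <;> simp [polyCone, evalRow] <;> grind
  · rcases hs with rfl | rfl <;>
      simp [polyCone, evalRow]
  · intro x hx
    rcases hs with rfl | rfl <;>
      simp [polyCone, evalRow, Fin.exists_fin_succ] at hx ⊢ <;>
      grind

set_option maxHeartbeats 2000000 in
theorem isBook_neg_y {t : ℝ} (ht : t = 0 ∨ t = 1) :
    IsBook fiveUnion fiveLines ![0, -1, t]
      (fun i : Fin 4 => polyCone [] (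
        ![[![1, 0, 0], ![0, -t, -1], ![0, -1, 0], ![0, t - 1, 2 * t - 1]],
        [![1, 0, 0], ![0, t, 1], ![0, -1, 0], ![0, t - 1, 2 * t - 1]],
        [![-1, 0, 0], ![0, t, 1], ![0, -1, 0], ![0, t - 1, 2 * t - 1]],
        [![-1, 0, 0], ![0, -t, -1], ![0, -1, 0], ![0, t - 1, 2 * t - 1]]] i))
      (fun i : Fin 4 => polyCone (![[![0, t, 1]],
        [![1, 0, 0]],
        [![0, t, 1]],
        [![1, 0, 0]]] i)
        (![[![1, 0, 0], ![0, -1, 0], ![0, t - 1, 2 * t - 1]],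
        [![0, t, 1], ![0, -1, 0], ![0, t - 1, 2 * t - 1]],
        [![-1, 0, 0], ![0, -1, 0], ![0, t - 1, 2 * t - 1]],
        [![0, -t, -1], ![0, -1, 0], ![0, t - 1, 2 * t - 1]]] i)) := by
  refine IsBook.of_polyCone _ _ _
    ![[![1, 0, 0], ![0, -1, 0], ![0, t - 1, 2 * t - 1]],
      [![0, t, 1], ![0, -1, 0], ![0, t - 1, 2 * t - 1]],
      [![-1, 0, 0], ![0, -1, 0], ![0, t - 1, 2 * t - 1]],
      [![0, -t, -1], ![0, -1, 0], ![0, t - 1, 2 * t - 1]]]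
    [![0, -1, 0], ![0, t - 1, 2 * t - 1]]
    ![![1, -2, 2 * t - 1],
      ![1, -2, 2 * t + 1],
      ![-1, -2, 2 * t + 1],
      ![-1, -2, 2 * t - 1]]
    ![![1, -1, t],
      ![0, -2, 2 * t + 1],
      ![-1, -1, t],
      ![0, -2, 2 * t - 1]]
    ?_ ?_ ?_ ?_ ?_ ?_ ?_ ?_ ?_ ?_ ?_ ?_
  · rcases ht with rfl | rfl <;>
      simp [fiveLines]
  · intro i x hx hS
    rcases ht with rfl | rfl <;>
      fin_cases i <;> simp [polyCone, evalRow, fiveUnion] at hx hS <;>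
      rcases abs_cases (x 0) with ⟨h, _⟩ | ⟨h, _⟩ <;> rw [h] at hS <;> grind
  · intro i j hij x hx hx'
    rcases ht with rfl | rfl <;>
      fin_cases i <;> fin_cases j <;> simp [polyCone, evalRow] at hx hx' hij <;> linarith
  · intro i
    rcases ht with rfl | rfl <;>
      fin_cases i <;> simp [polyCone, evalRow] <;> norm_num
  · intro i
    rcases ht with rfl | rfl <;>
      fin_cases i <;> simp [evalRow]
  · intro i x hx
    rcases ht with rfl | rfl <;>
      fin_cases i <;> simp [polyCone, evalRow, fiveUnion, fiveLines] at hx ⊢ <;>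
      rcases abs_cases (x 0) with ⟨h, _⟩ | ⟨h, _⟩ <;> simp only [h] <;> grind
  · intro i
    rcases ht with rfl | rfl <;>
      fin_cases i <;> simp [polyCone, evalRow] <;> norm_num
  · intro i
    rcases ht with rfl | rfl <;>
      fin_cases i <;> simp [evalRow]
  · intro i
    rcases ht with rfl | rfl <;>
      fin_cases i <;> simp [evalRow]
  · intro i x
    rcases ht with rfl | rfl <;>
      fin_cases i <;> simp [polyCone, evalRow] <;> grind
  · rcases ht with rfl | rfl <;>
      simp [polyCone, evalRow]
  · intro x hx
    rcases ht with rfl | rfl <;>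
      simp [polyCone, evalRow, Fin.exists_fin_succ] at hx ⊢ <;>
      grind

theorem IsTopoplane.isClosed {n : ℕ} {H : Set (Fin n → ℝ)} (h : IsTopoplane H) : IsClosed H := by
  obtain ⟨e, he⟩ := h
  rw [← e.isClosed_image, he]
  have : coordHyp n 0 = ⋂ h : 0 < n, {x | x ⟨0, h⟩ = 0} := by
    ext x
    simp [coordHyp]
  rw [this]
  exact isClosed_iInter fun h => isClosed_eq (continuous_apply _) continuous_const

theorem HasDim.of_image {n : ℕ} {Y : Set (Fin n → ℝ)} {d : ℕ} (e : (Fin n → ℝ) ≃ₜ (Fin n → ℝ))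
    (h : HasDim (e '' Y) d) : HasDim Y d := by
  obtain ⟨f⟩ := h
  exact ⟨(e.image Y).trans f⟩

/-- A set parametrised by a continuous map with a continuous left inverse on the whole space. -/
theorem HasDim.of_param {n d : ℕ} {Y : Set (Fin n → ℝ)} (γ : (Fin d → ℝ) → Fin n → ℝ)
    (c : (Fin n → ℝ) → Fin d → ℝ) (hγ : Continuous γ) (hc : Continuous c)
    (hcγ : ∀ t, c (γ t) = t) (hγY : ∀ t, γ t ∈ Y) (hγc : ∀ x ∈ Y, γ (c x) = x) : HasDim Y d :=
  ⟨{  toFun := fun y => c y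
      invFun := fun t => ⟨γ t, hγY t⟩
      left_inv := fun y => Subtype.ext (hγc y y.2)
      right_inv := hcγ
      continuous_toFun := by fun_prop
      continuous_invFun := by fun_prop }⟩

theorem IsRelTopoplane.of_param {n d : ℕ} {Y Z : Set (Fin n → ℝ)} (hd : 1 ≤ d) (hZY : Z ⊆ Y)
    (γ : (Fin d → ℝ) → Fin n → ℝ)
    (c : (Fin n → ℝ) → Fin d → ℝ) (hγ : Continuous γ) (hc : Continuous c)
    (hcγ : ∀ t, c (γ t) = t) (hγY : ∀ t, γ t ∈ Y) (hγc : ∀ x ∈ Y, γ (c x) = x)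
    (hZ : ∀ x ∈ Y, x ∈ Z ↔ c x ⟨0, hd⟩ = 0) : IsRelTopoplane Y Z := by
  refine ⟨hZY, d, hd,
    { toFun := fun y => c y
      invFun := fun t => ⟨γ t, hγY t⟩
      left_inv := fun y => Subtype.ext (hγc y y.2)
      right_inv := hcγ
      continuous_toFun := by fun_prop
      continuous_invFun := by fun_prop }, ?_⟩
  ext t
  constructor
  · rintro ⟨y, hy, rfl⟩ _
    exact (hZ y y.2).1 hy
  · intro ht
    refine ⟨⟨γ t, hγY t⟩, (hZ _ (hγY t)).2 ?_, hcγ t⟩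
    rw [hcγ]
    exact ht hd

theorem IsTopoplane.hasDim_two {H : Set (Fin 3 → ℝ)} (h : IsTopoplane H) : HasDim H 2 := by
  obtain ⟨e, he⟩ := h
  refine HasDim.of_image e ?_
  rw [he]
  refine HasDim.of_param (fun t => ![0, t 0, t 1]) (fun x => ![x 1, x 2]) ?_ ?_ ?_ ?_ ?_
  · refine continuous_pi fun i => ?_
    fin_cases i <;> simp <;> fun_prop
  · refine continuous_pi fun i => ?_
    fin_cases i <;> simp <;> fun_prop
  · intro t
    ext i
    fin_cases i <;> simp
  · intro t
    simp [coordHyp]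
  · intro x hx
    have h0 : x 0 = 0 := hx (by norm_num)
    ext i
    fin_cases i <;> simp [h0]

theorem Crosses.hasDim_one {A B : Set (Fin 3 → ℝ)} (h : Crosses A B) : HasDim (A ∩ B) 1 := by
  obtain ⟨e, hA, hB⟩ := h
  refine HasDim.of_image e ?_
  rw [image_inter e.injective, hA, hB]
  refine HasDim.of_param (fun t => ![0, 0, t 0]) (fun x => ![x 2]) ?_ ?_ ?_ ?_ ?_
  · refine continuous_pi fun i => ?_
    fin_cases i <;> simp <;> fun_prop
  · refine continuous_pi fun i => ?_
    fin_cases i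
    simp
    fun_prop
  · intro t
    ext i
    fin_cases i
    simp
  · intro t
    simp [coordHyp]
  · intro x hx
    have h0 : x 0 = 0 := hx.1 (by norm_num)
    have h1 : x 1 = 0 := hx.2 (by norm_num)
    ext i
    fin_cases i <;> simp [h0, h1]

theorem HasDim.three_le_of_univ {m : ℕ} (h : HasDim (univ : Set (Fin 3 → ℝ)) m) : 3 ≤ m := by
  obtain ⟨e⟩ := h
  exact three_le_of_homeomorph ((Homeomorph.Set.univ _).symm.trans e)

theorem HasDim.eq_one_of {n m : ℕ} {Y : Set (Fin n → ℝ)} (h : HasDim Y 1) (hm : HasDim Y m)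
    (h1 : 1 ≤ m) : m = 1 := by
  obtain ⟨e⟩ := h
  obtain ⟨f⟩ := hm
  by_contra hne
  have := two_le_of_homeomorph (by omega) (f.symm.trans e)
  omega

theorem isFlat_inter {n : ℕ} {𝓗 : Set (Set (Fin n → ℝ))} {A B : Set (Fin n → ℝ)} (hA : A ∈ 𝓗)
    (hB : B ∈ 𝓗) (hne : (A ∩ B).Nonempty) : IsFlat 𝓗 (A ∩ B) :=
  ⟨⟨{A, B}, insert_subset hA (singleton_subset_iff.2 hB), by rw [sInter_pair]⟩, hne⟩

theorem skeleton_two_eq {𝓗 : Set (Set (Fin 3 → ℝ))} (h : ∀ H ∈ 𝓗, IsTopoplane H) :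
    skeleton 𝓗 2 = ⋃₀ 𝓗 := by
  ext x
  constructor
  · rintro ⟨Y, ⟨⟨⟨𝓢, h𝓢, rfl⟩, -⟩, d, hd, hdim⟩, hx⟩
    rcases 𝓢.eq_empty_or_nonempty with rfl | ⟨A, hA⟩
    · rw [sInter_empty] at hdim
      have := hdim.three_le_of_univ
      omega
    · exact ⟨A, h𝓢 hA, hx A hA⟩
  · rintro ⟨A, hA, hx⟩
    have hflat := isFlat_inter hA hA ⟨x, hx, hx⟩
    rw [inter_self] at hflat
    exact ⟨A, ⟨hflat, 2, le_rfl, (h A hA).hasDim_two⟩, hx⟩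

theorem exists_two_of_mem_skeleton_one {𝓗 : Set (Set (Fin 3 → ℝ))}
    (h : ∀ H ∈ 𝓗, IsTopoplane H) {x : Fin 3 → ℝ} (hx : x ∈ skeleton 𝓗 1) :
    ∃ A ∈ 𝓗, ∃ B ∈ 𝓗, A ≠ B ∧ x ∈ A ∧ x ∈ B := by
  obtain ⟨Y, ⟨⟨⟨𝓢, h𝓢, rfl⟩, -⟩, d, hd, hdim⟩, hx⟩ := hx
  rcases 𝓢.eq_empty_or_nonempty with rfl | ⟨A, hA⟩
  · rw [sInter_empty] at hdim
    have := hdim.three_le_of_univ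
    omega
  · by_cases hs : ∀ B ∈ 𝓢, A = B
    · have h𝓢A : ⋂₀ 𝓢 = A :=
        Subset.antisymm (sInter_subset_of_mem hA) fun y hy B hB => hs B hB ▸ hy
      rw [h𝓢A] at hdim
      obtain ⟨e⟩ := hdim
      obtain ⟨f⟩ := (h A (h𝓢 hA)).hasDim_two
      have := two_le_of_homeomorph le_rfl (f.symm.trans e)
      omega
    · push Not at hs
      obtain ⟨B, hB, hAB⟩ := hs
      exact ⟨A, h𝓢 hA, B, h𝓢 hB, hAB, hx A hA, hx B hB⟩

theorem mem_skeleton_of_mem_inter {n k d : ℕ} {𝓗 : Set (Set (Fin n → ℝ))} {A B : Set (Fin n → ℝ)}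
    (hA : A ∈ 𝓗) (hB : B ∈ 𝓗) (hdim : HasDim (A ∩ B) d) (hd : d ≤ k) {x : Fin n → ℝ}
    (hx : x ∈ A ∩ B) : x ∈ skeleton 𝓗 k :=
  ⟨A ∩ B, ⟨isFlat_inter hA hB ⟨x, hx⟩, d, hd, hdim⟩, hx⟩

theorem isCrossingFamily_of_skeleton {𝓗 : Set (Set (Fin 3 → ℝ))} (h : IsArrangement 𝓗)
    (haff : PairwiseAffine 𝓗) {S S₁ : Set (Fin 3 → ℝ)} (hS : skeleton 𝓗 2 = S)
    (hS₁ : skeleton 𝓗 1 = S₁) (hdense : Dense Sᶜ) : IsCrossingFamily 𝓗 S S₁ := by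
  have hcross : ∀ A ∈ 𝓗, ∀ B ∈ 𝓗, A ≠ B → (A ∩ B).Nonempty → Crosses A B :=
    fun A hA B hB hAB hne => (haff A hA B hB hAB).resolve_left hne.ne_empty
  refine ⟨h.1, fun T hT => (h.2.1 T hT).isClosed, (skeleton_two_eq h.2.1).symm.trans hS, hdense,
    fun A hA B hB hAB x hx => ?_, fun p hp => ?_, hcross⟩
  · rw [← hS₁]
    exact mem_skeleton_of_mem_inter hA hB (hcross A hA B hB hAB ⟨x, hx⟩).hasDim_one le_rfl hx
  · rw [← hS₁] at hp
    exact exists_two_of_mem_skeleton_one h.2.1 hp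

theorem IsTopoplane.isRelTopoplane_univ {n : ℕ} (hn : 1 ≤ n) {H : Set (Fin n → ℝ)}
    (h : IsTopoplane H) : IsRelTopoplane univ H := by
  obtain ⟨e, he⟩ := h
  refine ⟨subset_univ _, n, hn, (Homeomorph.Set.univ _).trans e, ?_⟩
  rw [← he]
  ext t
  simp

/-- `Y` is the image of a continuous section of a coordinate function, passing through the origin,
which every member of `𝓗` not containing it meets in the origin only. -/
def IsTransverseLine {n : ℕ} (𝓗 : Set (Set (Fin n → ℝ))) (Y : Set (Fin n → ℝ)) : Prop :=
  ∃ (γ : ℝ → Fin n → ℝ) (i : Fin n), Continuous γ ∧ (∀ t, γ t i = t) ∧ γ 0 = 0 ∧ range γ = Y ∧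
    ∀ H ∈ 𝓗, (∀ t, γ t ∈ H) ∨ ∀ t, γ t ∈ H ↔ t = 0

namespace IsTransverseLine

variable {n : ℕ} {𝓗 : Set (Set (Fin n → ℝ))} {Y H : Set (Fin n → ℝ)}

theorem hasDim_one (h : IsTransverseLine 𝓗 Y) : HasDim Y 1 := by
  obtain ⟨γ, i, hγ, hi, -, rfl, -⟩ := h
  refine HasDim.of_param (fun t => γ (t 0)) (fun x _ => x i) (by fun_prop) (by fun_prop)
    (fun t => ?_) (fun t => mem_range_self _) ?_
  · ext j
    rw [hi, Subsingleton.elim j 0]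
  · rintro _ ⟨t, rfl⟩
    exact congrArg γ (hi t)

theorem subset_or (h : IsTransverseLine 𝓗 Y) (hH : H ∈ 𝓗) :
    Y ⊆ H ∨ IsRelTopoplane Y (H ∩ Y) ∧ H ∩ Y = {0} := by
  obtain ⟨γ, i, hγ, hi, h0, rfl, hγH⟩ := h
  rcases hγH H hH with h1 | h1
  · exact Or.inl (range_subset_iff.2 h1)
  · refine Or.inr ⟨IsRelTopoplane.of_param le_rfl inter_subset_right (fun t => γ (t 0))
      (fun x _ => x i) (by fun_prop) (by fun_prop) (fun t => ?_) (fun t => mem_range_self _) ?_ ?_,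
      ?_⟩
    · ext j
      rw [hi, Subsingleton.elim j 0]
    · rintro _ ⟨t, rfl⟩
      exact congrArg γ (hi t)
    · rintro _ ⟨t, rfl⟩
      simp [h1, hi]
    · ext x
      constructor
      · rintro ⟨hx, t, rfl⟩
        rw [(h1 t).1 hx, h0]
        rfl
      · rintro rfl
        rw [← h0]
        exact ⟨(h1 0).2 rfl, mem_range_self _⟩

end IsTransverseLine

/-- A finite family of topoplanes through the origin whose pairwise intersections are transverse
lines is an arrangement. -/
theorem isArrangement_of_isTransverseLine {n : ℕ} (hn : 1 ≤ n) {𝓗 : Set (Set (Fin n → ℝ))}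
    (hfin : 𝓗.Finite) (htop : ∀ H ∈ 𝓗, IsTopoplane H) (h0 : ∀ H ∈ 𝓗, 0 ∈ H)
    (hrel : ∀ H ∈ 𝓗, ∀ K ∈ 𝓗, H ≠ K → IsRelTopoplane K (H ∩ K))
    (hline : ∀ H ∈ 𝓗, ∀ K ∈ 𝓗, H ≠ K → IsTransverseLine 𝓗 (H ∩ K)) : IsArrangement 𝓗 := by
  have hflat : ∀ 𝓢 ⊆ 𝓗, ⋂₀ 𝓢 = univ ∨ ⋂₀ 𝓢 ∈ 𝓗 ∨ IsTransverseLine 𝓗 (⋂₀ 𝓢) ∨ ⋂₀ 𝓢 = {0} := by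
    intro 𝓢 h𝓢
    refine Set.Finite.induction_on_subset (motive := fun 𝓣 _ => ⋂₀ 𝓣 = univ ∨ ⋂₀ 𝓣 ∈ 𝓗 ∨
      IsTransverseLine 𝓗 (⋂₀ 𝓣) ∨ ⋂₀ 𝓣 = {0}) 𝓢 (hfin.subset h𝓢) (by simp) ?_
    rintro H 𝓣 hH h𝓣 - ih
    have hH := h𝓢 hH
    rw [sInter_insert]
    rcases ih with h | h | h | h
    · rw [h, inter_univ]
      exact Or.inr (Or.inl hH)
    · by_cases heq : H = ⋂₀ 𝓣
      · rw [← heq, inter_self]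
        exact Or.inr (Or.inl hH)
      · exact Or.inr (Or.inr (Or.inl (hline H hH _ h heq)))
    · rcases h.subset_or hH with h1 | h1
      · rw [inter_eq_right.2 h1]
        exact Or.inr (Or.inr (Or.inl h))
      · exact Or.inr (Or.inr (Or.inr h1.2))
    · rw [h, inter_eq_right.2 (singleton_subset_iff.2 (h0 H hH))]
      simp
  refine ⟨hfin, htop, ?_⟩
  rintro H hH _ ⟨⟨𝓢, h𝓢, rfl⟩, -⟩
  rcases hflat 𝓢 h𝓢 with h | h | h | h
  · rw [h, inter_univ]
    exact Or.inr (Or.inr ((htop H hH).isRelTopoplane_univ hn))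
  · by_cases heq : H = ⋂₀ 𝓢
    · exact Or.inl heq.symm.subset
    · exact Or.inr (Or.inr (hrel H hH _ h heq))
  · exact (h.subset_or hH).imp_right fun h1 => Or.inr h1.1
  · rw [h]
    exact Or.inl (singleton_subset_iff.2 (h0 H hH))

theorem IsTopoplane.of_coordinates {H : Set (Fin 3 → ℝ)} (γ c : (Fin 3 → ℝ) → Fin 3 → ℝ)
    (hγ : Continuous γ) (hc : Continuous c) (hcγ : ∀ t, c (γ t) = t) (hγc : ∀ x, γ (c x) = x)
    (hH : ∀ x, x ∈ H ↔ c x 0 = 0) : IsTopoplane H := by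
  refine ⟨⟨⟨c, γ, hγc, hcγ⟩, hc, hγ⟩, ?_⟩
  ext t
  constructor
  · rintro ⟨x, hx, rfl⟩ _
    exact (hH x).1 hx
  · intro ht
    refine ⟨γ t, (hH _).2 ?_, hcγ t⟩
    rw [hcγ]
    exact ht (by norm_num)

theorem IsRelTopoplane.of_coordinates {Y H : Set (Fin 3 → ℝ)} (γ : ℝ → ℝ → Fin 3 → ℝ)
    (c₀ c₁ : (Fin 3 → ℝ) → ℝ) (hγ : Continuous fun p : ℝ × ℝ => γ p.1 p.2) (hc₀ : Continuous c₀)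
    (hc₁ : Continuous c₁) (hcγ : ∀ s t, γ s t ∈ Y ∧ c₀ (γ s t) = s ∧ c₁ (γ s t) = t)
    (hγc : ∀ x ∈ Y, γ (c₀ x) (c₁ x) = x ∧ (x ∈ H ↔ c₀ x = 0)) : IsRelTopoplane Y (H ∩ Y) := by
  refine IsRelTopoplane.of_param (d := 2) (by norm_num) inter_subset_right
    (fun t => γ (t 0) (t 1)) (fun x => ![c₀ x, c₁ x])
    (hγ.comp (f := fun t : Fin 2 → ℝ => (t 0, t 1)) (by fun_prop)) ?_ (fun t => ?_)
    (fun t => (hcγ _ _).1) (fun x hx => (hγc x hx).1) (fun x hx => ?_)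
  · refine continuous_pi fun i => ?_
    fin_cases i <;> simpa
  · ext i
    fin_cases i
    · exact (hcγ _ _).2.1
    · exact (hcγ _ _).2.2
  · simp [hx, (hγc x hx).2]

theorem continuous_vec_three {X : Type*} [TopologicalSpace X] {a b c : X → ℝ} (ha : Continuous a)
    (hb : Continuous b) (hc : Continuous c) : Continuous fun x => ![a x, b x, c x] := by
  refine continuous_pi fun i => ?_
  fin_cases i <;> simpa

/-- The arrangement under consideration. -/
def fiveFamily : Set (Set (Fin 3 → ℝ)) :=
  {{x | x 0 = 0}, {x | x 1 = 0}, {x | x 1 = |x 0|}, {x | x 2 = 0}, {x | x 1 + x 2 = 0}}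

theorem forall_mem_fiveFamily {P : Set (Fin 3 → ℝ) → Prop} :
    (∀ H ∈ fiveFamily, P H) ↔ P {x | x 0 = 0} ∧ P {x | x 1 = 0} ∧ P {x | x 1 = |x 0|} ∧
      P {x | x 2 = 0} ∧ P {x | x 1 + x 2 = 0} := by
  simp [fiveFamily]

theorem isTopoplane_of_mem_fiveFamily : ∀ H ∈ fiveFamily, IsTopoplane H := by
  rw [forall_mem_fiveFamily]
  refine ⟨.of_coordinates (fun t => ![t 0, t 1, t 2]) (fun x => ![x 0, x 1, x 2]) ?_ ?_ ?_ ?_ ?_,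
    .of_coordinates (fun t => ![t 1, t 0, t 2]) (fun x => ![x 1, x 0, x 2]) ?_ ?_ ?_ ?_ ?_,
    .of_coordinates (fun t => ![t 1, t 0 + |t 1|, t 2]) (fun x => ![x 1 - |x 0|, x 0, x 2])
      ?_ ?_ ?_ ?_ ?_,
    .of_coordinates (fun t => ![t 1, t 2, t 0]) (fun x => ![x 2, x 0, x 1]) ?_ ?_ ?_ ?_ ?_,
    .of_coordinates (fun t => ![t 1, t 2, t 0 - t 2]) (fun x => ![x 1 + x 2, x 0, x 1])
      ?_ ?_ ?_ ?_ ?_⟩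
  all_goals first
    | exact continuous_vec_three (by fun_prop) (by fun_prop) (by fun_prop)
    | (intro x; simp [sub_eq_zero]; done)
    | (intro x; ext i; fin_cases i <;> simp)

theorem isTransverseLine_inter {𝓗 : Set (Set (Fin 3 → ℝ))} {H K : Set (Fin 3 → ℝ)}
    (γ : ℝ → Fin 3 → ℝ) (i : Fin 3) (hγ : Continuous γ) (h0 : γ 0 = 0)
    (hi : ∀ t, γ t i = t ∧ γ t ∈ H ∧ γ t ∈ K) (hγY : ∀ x, x ∈ H → x ∈ K → γ (x i) = x)
    (hH : ∀ H ∈ 𝓗, (∀ t, γ t ∈ H) ∨ ∀ t, γ t ∈ H ↔ t = 0) : IsTransverseLine 𝓗 (H ∩ K) :=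
  ⟨γ, i, hγ, fun t => (hi t).1, h0, Subset.antisymm (range_subset_iff.2 fun t => (hi t).2)
    fun x hx => ⟨x i, hγY x hx.1 hx.2⟩, hH⟩

theorem isTransverseLine_of_mem_fiveFamily :
    ∀ H ∈ fiveFamily, ∀ K ∈ fiveFamily, H ≠ K → IsTransverseLine fiveFamily (H ∩ K) := by
  simp only [forall_mem_fiveFamily]
  refine ⟨⟨fun h => (h rfl).elim,
      fun _ => isTransverseLine_inter (fun t => ![0, 0, t]) 2 ?_ ?_ ?_ ?_ ?_,
      fun _ => isTransverseLine_inter (fun t => ![0, 0, t]) 2 ?_ ?_ ?_ ?_ ?_,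
      fun _ => isTransverseLine_inter (fun t => ![0, t, 0]) 1 ?_ ?_ ?_ ?_ ?_,
      fun _ => isTransverseLine_inter (fun t => ![0, t, -t]) 1 ?_ ?_ ?_ ?_ ?_⟩,
    ⟨fun _ => isTransverseLine_inter (fun t => ![0, 0, t]) 2 ?_ ?_ ?_ ?_ ?_,
      fun h => (h rfl).elim,
      fun _ => isTransverseLine_inter (fun t => ![0, 0, t]) 2 ?_ ?_ ?_ ?_ ?_,
      fun _ => isTransverseLine_inter (fun t => ![t, 0, 0]) 0 ?_ ?_ ?_ ?_ ?_,
      fun _ => isTransverseLine_inter (fun t => ![t, 0, 0]) 0 ?_ ?_ ?_ ?_ ?_⟩,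
    ⟨fun _ => isTransverseLine_inter (fun t => ![0, 0, t]) 2 ?_ ?_ ?_ ?_ ?_,
      fun _ => isTransverseLine_inter (fun t => ![0, 0, t]) 2 ?_ ?_ ?_ ?_ ?_,
      fun h => (h rfl).elim,
      fun _ => isTransverseLine_inter (fun t => ![t, |t|, 0]) 0 ?_ ?_ ?_ ?_ ?_,
      fun _ => isTransverseLine_inter (fun t => ![t, |t|, -|t|]) 0 ?_ ?_ ?_ ?_ ?_⟩,
    ⟨fun _ => isTransverseLine_inter (fun t => ![0, t, 0]) 1 ?_ ?_ ?_ ?_ ?_,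
      fun _ => isTransverseLine_inter (fun t => ![t, 0, 0]) 0 ?_ ?_ ?_ ?_ ?_,
      fun _ => isTransverseLine_inter (fun t => ![t, |t|, 0]) 0 ?_ ?_ ?_ ?_ ?_,
      fun h => (h rfl).elim,
      fun _ => isTransverseLine_inter (fun t => ![t, 0, 0]) 0 ?_ ?_ ?_ ?_ ?_⟩,
    ⟨fun _ => isTransverseLine_inter (fun t => ![0, t, -t]) 1 ?_ ?_ ?_ ?_ ?_,
      fun _ => isTransverseLine_inter (fun t => ![t, 0, 0]) 0 ?_ ?_ ?_ ?_ ?_,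
      fun _ => isTransverseLine_inter (fun t => ![t, |t|, -|t|]) 0 ?_ ?_ ?_ ?_ ?_,
      fun _ => isTransverseLine_inter (fun t => ![t, 0, 0]) 0 ?_ ?_ ?_ ?_ ?_,
      fun h => (h rfl).elim⟩⟩
  all_goals first
    | exact continuous_vec_three (by fun_prop) (by fun_prop) (by fun_prop)
    | (ext i; fin_cases i <;> simp)
    | (intro t; simp; done)
    | (intro x hx hx'; simp only [mem_ofPred_eq] at hx hx'; ext i; fin_cases i <;> simp <;> grind)
    | (rw [forall_mem_fiveFamily]
       refine ⟨?_, ?_, ?_, ?_, ?_⟩ <;> first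
         | (left; intro t; simp; done)
         | (right; intro t; simp [eq_comm (a := (0 : ℝ))]))

theorem isRelTopoplane_of_mem_fiveFamily :
    ∀ H ∈ fiveFamily, ∀ K ∈ fiveFamily, H ≠ K → IsRelTopoplane K (H ∩ K) := by
  simp only [forall_mem_fiveFamily]
  refine ⟨⟨fun h => (h rfl).elim,
      fun _ => .of_coordinates (fun s t => ![s, 0, t]) (· 0) (· 2) ?_ ?_ ?_ ?_ ?_,
      fun _ => .of_coordinates (fun s t => ![s, |s|, t]) (· 0) (· 2) ?_ ?_ ?_ ?_ ?_,
      fun _ => .of_coordinates (fun s t => ![s, t, 0]) (· 0) (· 1) ?_ ?_ ?_ ?_ ?_,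
      fun _ => .of_coordinates (fun s t => ![s, t, -t]) (· 0) (· 1) ?_ ?_ ?_ ?_ ?_⟩,
    ⟨fun _ => .of_coordinates (fun s t => ![0, s, t]) (· 1) (· 2) ?_ ?_ ?_ ?_ ?_,
      fun h => (h rfl).elim,
      fun _ => .of_coordinates (fun s t => ![s, |s|, t]) (· 0) (· 2) ?_ ?_ ?_ ?_ ?_,
      fun _ => .of_coordinates (fun s t => ![t, s, 0]) (· 1) (· 0) ?_ ?_ ?_ ?_ ?_,
      fun _ => .of_coordinates (fun s t => ![t, s, -s]) (· 1) (· 0) ?_ ?_ ?_ ?_ ?_⟩,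
    ⟨fun _ => .of_coordinates (fun s t => ![0, s, t]) (· 1) (· 2) ?_ ?_ ?_ ?_ ?_,
      fun _ => .of_coordinates (fun s t => ![s, 0, t]) (· 0) (· 2) ?_ ?_ ?_ ?_ ?_,
      fun h => (h rfl).elim,
      fun _ => .of_coordinates (fun s t => ![t, s + |t|, 0])
        (fun x => x 1 - |x 0|) (· 0) ?_ ?_ ?_ ?_ ?_,
      fun _ => .of_coordinates (fun s t => ![t, s + |t|, -(s + |t|)])
        (fun x => x 1 - |x 0|) (· 0) ?_ ?_ ?_ ?_ ?_⟩,
    ⟨fun _ => .of_coordinates (fun s t => ![0, t, s]) (· 2) (· 1) ?_ ?_ ?_ ?_ ?_,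
      fun _ => .of_coordinates (fun s t => ![t, 0, s]) (· 2) (· 0) ?_ ?_ ?_ ?_ ?_,
      fun _ => .of_coordinates (fun s t => ![t, |t|, s]) (· 2) (· 0) ?_ ?_ ?_ ?_ ?_,
      fun h => (h rfl).elim,
      fun _ => .of_coordinates (fun s t => ![t, s, -s]) (· 1) (· 0) ?_ ?_ ?_ ?_ ?_⟩,
    ⟨fun _ => .of_coordinates (fun s t => ![0, s - t, t]) (fun x => x 1 + x 2) (· 2) ?_ ?_ ?_ ?_ ?_,
      fun _ => .of_coordinates (fun s t => ![t, 0, s]) (· 2) (· 0) ?_ ?_ ?_ ?_ ?_,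
      fun _ => .of_coordinates (fun s t => ![t, |t|, s - |t|])
        (fun x => x 2 + |x 0|) (· 0) ?_ ?_ ?_ ?_ ?_,
      fun _ => .of_coordinates (fun s t => ![t, s, 0]) (· 1) (· 0) ?_ ?_ ?_ ?_ ?_,
      fun h => (h rfl).elim⟩⟩
  all_goals first
    | exact continuous_vec_three (by fun_prop) (by fun_prop) (by fun_prop)
    | (intro s t; simp; done)
    | (intro x hx; simp only [mem_ofPred_eq] at hx ⊢; refine ⟨?_, by grind⟩; ext i
       fin_cases i <;> simp; grind)
    | fun_prop

theorem isArrangement_fiveFamily : IsArrangement fiveFamily := by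
  refine isArrangement_of_isTransverseLine (by norm_num) ?_ isTopoplane_of_mem_fiveFamily ?_
    isRelTopoplane_of_mem_fiveFamily isTransverseLine_of_mem_fiveFamily
  · simp [fiveFamily]
  · simp [forall_mem_fiveFamily]

theorem skeleton_two_fiveFamily : skeleton fiveFamily 2 = fiveUnion := by
  rw [skeleton_two_eq isTopoplane_of_mem_fiveFamily]
  ext x
  simp [fiveFamily, fiveUnion]

theorem skeleton_one_fiveFamily : skeleton fiveFamily 1 = fiveLines := by
  ext x
  constructor
  · intro hx
    obtain ⟨A, hA, B, hB, hAB, hxA, hxB⟩ :=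
      exists_two_of_mem_skeleton_one isTopoplane_of_mem_fiveFamily hx
    simp only [fiveFamily, mem_insert_iff, mem_singleton_iff] at hA hB
    simp only [fiveLines, mem_ofPred_eq]
    rcases hA with rfl | rfl | rfl | rfl | rfl <;> rcases hB with rfl | rfl | rfl | rfl | rfl <;>
      first
        | exact (hAB rfl).elim
        | (simp only [mem_ofPred_eq] at hxA hxB; grind)
  · intro hx
    have key : ∀ A ∈ fiveFamily, ∀ B ∈ fiveFamily, ∀ y, y ∈ A → y ∉ B → x ∈ A ∩ B →
        x ∈ skeleton fiveFamily 1 := fun A hA B hB y hyA hyB hxAB =>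
      mem_skeleton_of_mem_inter hA hB (isTransverseLine_of_mem_fiveFamily A hA B hB
        fun h => hyB (h ▸ hyA)).hasDim_one le_rfl hxAB
    rcases hx with hx | hx | hx | hx | hx | hx
    · exact key {x | x 0 = 0} (by simp [fiveFamily]) {x | x 1 = 0} (by simp [fiveFamily])
        ![0, 1, 0] (by simp) (by simp) hx
    · exact key {x | x 0 = 0} (by simp [fiveFamily]) {x | x 2 = 0} (by simp [fiveFamily])
        ![0, 0, 1] (by simp) (by simp) hx
    · exact key {x | x 0 = 0} (by simp [fiveFamily]) {x | x 1 + x 2 = 0} (by simp [fiveFamily])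
        ![0, 0, 1] (by simp) (by simp) hx
    · exact key {x | x 1 = 0} (by simp [fiveFamily]) {x | x 2 = 0} (by simp [fiveFamily])
        ![0, 0, 1] (by simp) (by simp) hx
    · exact key {x | x 1 = |x 0|} (by simp [fiveFamily]) {x | x 2 = 0} (by simp [fiveFamily])
        ![0, 0, 1] (by simp) (by simp) hx
    · exact key {x | x 1 = |x 0|} (by simp [fiveFamily]) {x | x 1 + x 2 = 0} (by simp [fiveFamily])
        ![0, 0, 1] (by simp) (by simp) hx

theorem IsTopoplane.dense_compl {H : Set (Fin 3 → ℝ)} (h : IsTopoplane H) : Dense Hᶜ := by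
  obtain ⟨e, he⟩ := h
  have h0 : Dense (coordHyp 3 0)ᶜ := by
    have : (coordHyp 3 0)ᶜ = (fun x : Fin 3 → ℝ => x 0) ⁻¹' {0}ᶜ := by
      ext x
      simp [coordHyp]
    rw [this]
    exact (dense_compl_singleton (0 : ℝ)).preimage (isOpenMap_eval 0)
  rw [← he, ← image_compl_eq e.bijective] at h0
  simpa [preimage_image_eq _ e.injective] using h0.preimage e.isOpenMap

theorem dense_compl_sUnion {𝓗 : Set (Set (Fin 3 → ℝ))} (hfin : 𝓗.Finite)
    (h : ∀ H ∈ 𝓗, IsTopoplane H) : Dense (⋃₀ 𝓗)ᶜ := by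
  rw [compl_sUnion, sInter_image]
  exact dense_biInter_of_isOpen (fun H hH => (h H hH).isClosed.isOpen_compl) hfin.countable
    fun H hH => (h H hH).dense_compl

theorem isCrossingFamily_of_skeleton_eq {𝓗 : Set (Set (Fin 3 → ℝ))} (h : IsArrangement 𝓗)
    (haff : PairwiseAffine 𝓗) (hskel : ∀ k ≤ 3, skeleton 𝓗 k = skeleton fiveFamily k) :
    IsCrossingFamily 𝓗 fiveUnion fiveLines := by
  have h2 := (hskel 2 (by norm_num)).trans skeleton_two_fiveFamily
  refine isCrossingFamily_of_skeleton h haff h2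
    ((hskel 1 (by norm_num)).trans skeleton_one_fiveFamily) ?_
  rw [← h2, skeleton_two_eq h.2.1]
  exact dense_compl_sUnion h.1 h.2.1

namespace IsCrossingFamily

variable {𝓗 : Set (Set (Fin 3 → ℝ))} {S S₁ : Set (Fin 3 → ℝ)} {p : Fin 3 → ℝ}

/-- In an arrangement, a member meeting a one-dimensional intersection of two others in two points
contains it. -/
theorem inter_subset_of_ne (h : IsCrossingFamily 𝓗 S S₁) (harr : IsArrangement 𝓗)
    {A B C : Set (Fin 3 → ℝ)} (hA : A ∈ 𝓗) (hB : B ∈ 𝓗) (hC : C ∈ 𝓗) (hBC : B ≠ C)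
    {q : Fin 3 → ℝ} (hp : p ∈ A ∩ (B ∩ C)) (hq : q ∈ A ∩ (B ∩ C)) (hpq : p ≠ q) : B ∩ C ⊆ A := by
  have hdim := (h.crosses B hB C hC hBC ⟨p, hp.2⟩).hasDim_one
  rcases harr.2.2 A hA _ (isFlat_inter hB hC ⟨p, hp.2⟩) with h1 | h1 | ⟨-, d, hd, φ, hφ⟩
  · exact h1
  · exact (notMem_empty p (h1 ▸ hp)).elim
  · obtain rfl := hdim.eq_one_of ⟨φ⟩ hd
    have hzero : ∀ y (hy : y ∈ A ∩ (B ∩ C)), φ ⟨y, hy.2⟩ = 0 := by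
      intro y hy
      have : φ ⟨y, hy.2⟩ ∈ coordHyp 1 0 := hφ ▸ mem_image_of_mem φ hy
      ext i
      rw [Subsingleton.elim i 0]
      exact this one_pos
    exact (hpq (congrArg Subtype.val (φ.injective ((hzero p hp).trans (hzero q hq).symm)))).elim

theorem page_subset_of_mem (h : IsCrossingFamily 𝓗 S S₁) {m : ℕ} [NeZero m]
    {W F : Fin m → Set (Fin 3 → ℝ)} (hb : IsBook S S₁ p W F) {A : Set (Fin 3 → ℝ)} (hA : A ∈ 𝓗)
    {i : Fin m} {x : Fin 3 → ℝ} (hxA : x ∈ A) (hx : x ∈ F i) : F i ⊆ A :=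
  h.subset_of_inter_nonempty (hb.page_subset i) (hb.isPreconnected_page i) hA ⟨x, hx, hxA⟩

/-- The union and the singular set of the five topoplanes are not those of an affine arrangement. -/
theorem false_of_isArrangement (h : IsCrossingFamily 𝓗 fiveUnion fiveLines)
    (harr : IsArrangement 𝓗) : False := by
  have hbx := isBook_x (Or.inl rfl)
  have hbx' := isBook_x (Or.inr rfl)
  have hby := isBook_neg_y (Or.inl rfl)
  have hbd := isBook_neg_y (Or.inr rfl)
  have hbz := isBook_pos_z
  obtain ⟨A, hA, hA1⟩ := h.exists_subset (hbx.page_nonempty 1) (hbx.page_subset 1)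
    (hbx.isPreconnected_page 1)
  obtain ⟨B, hB, hB3⟩ := h.exists_subset (hbx.page_nonempty 3) (hbx.page_subset 3)
    (hbx.isPreconnected_page 3)
  obtain ⟨C, hC, hC2⟩ := h.exists_subset (hbx.page_nonempty 2) (hbx.page_subset 2)
    (hbx.isPreconnected_page 2)
  have hBC : B ≠ C := by
    rintro rfl
    have := (h.page_subset_iff_six hbx hB hB3 2).1 hC2
    revert this
    decide
  have hxA := h.mem_of_page_subset hbx hA hA1
  have hxB := h.mem_of_page_subset hbx hB hB3
  have hxC := h.mem_of_page_subset hbx hC hC2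
  have hB0 := h.page_subset_of_mem hby hB (i := 0)
    (hB3 (a := ![1, -1, 0]) (by simp [polyCone, evalRow])) (by simp [polyCone, evalRow])
  have hB2 := (h.page_subset_iff_four hby hB hB0 2).2 (by decide)
  have hB3' := h.page_subset_of_mem hbx' hB (i := 3)
    (hB2 (a := ![-1, -1, 0]) (by simp [polyCone, evalRow])) (by simp [polyCone, evalRow])
  have hC0 := h.page_subset_of_mem hbd hC (i := 0)
    (hC2 (a := ![1, -1, 1]) (by simp [polyCone, evalRow])) (by simp [polyCone, evalRow])
  have hC2d := (h.page_subset_iff_four hbd hC hC0 2).2 (by decide)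
  have hC2' := h.page_subset_of_mem hbx' hC (i := 2)
    (hC2d (a := ![-1, -1, 1]) (by simp [polyCone, evalRow])) (by simp [polyCone, evalRow])
  have hx2A : ![2, 0, 0] ∈ A := closure_minimal hA1 (h.isClosed A hA)
    (mem_closure_polyCone (q := ![1, 0, 1]) (by simp [polyCone, evalRow])
      (by simp [evalRow]) (by simp [evalRow]))
  have hx2B : ![2, 0, 0] ∈ B := closure_minimal hB3 (h.isClosed B hB)
    (mem_closure_polyCone (q := ![1, -1, 0]) (by simp [polyCone, evalRow])
      (by simp [evalRow]) (by simp [evalRow]))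
  have hx2C : ![2, 0, 0] ∈ C := closure_minimal hC2 (h.isClosed C hC)
    (mem_closure_polyCone (q := ![1, -1, 1]) (by simp [polyCone, evalRow])
      (by simp [evalRow]) (by simp [evalRow]))
  have hne : (![1, 0, 0] : Fin 3 → ℝ) ≠ ![2, 0, 0] := fun hh => by
    simpa using congrFun hh 0
  have hx'A : ![-1, 0, 0] ∈ A := h.inter_subset_of_ne harr hA hB hC hBC ⟨hxA, hxB, hxC⟩
    ⟨hx2A, hx2B, hx2C⟩ hne ⟨h.mem_of_page_subset hbx' hB hB3', h.mem_of_page_subset hbx' hC hC2'⟩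
  obtain ⟨i, hi⟩ := h.exists_page_subset hbx' hA hx'A
  have hpage := h.page_subset_iff_six hbx' hA hi
  have h1 : ¬ (3 = i ∨ 3 = i + 3) := by
    rw [← hpage]
    intro hA3
    obtain rfl := h.eq_of_subset (hbx'.page_nonempty 3) (hbx'.page_subset 3) hA hB hA3 hB3'
    have := (h.page_subset_iff_six hbx hA hA1 3).1 hB3
    revert this
    decide
  have h2 : ¬ (2 = i ∨ 2 = i + 3) := by
    rw [← hpage]
    intro hA2
    obtain rfl := h.eq_of_subset (hbx'.page_nonempty 2) (hbx'.page_subset 2) hA hC hA2 hC2'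
    have := (h.page_subset_iff_six hbx hA hA1 2).1 hC2
    revert this
    decide
  have hA1' := (hpage 1).2 (by revert h1 h2; clear hi hpage; revert i; decide)
  have hz0 := h.page_subset_of_mem hbz hA (i := 0)
    (hA1 (a := ![1, 0, 1]) (by simp [polyCone, evalRow])) (by simp [polyCone, evalRow])
  have hz4 := h.page_subset_of_mem hbz hA (i := 4)
    (hA1' (a := ![-1, 0, 1]) (by simp [polyCone, evalRow])) (by simp [polyCone, evalRow])
  have := (h.page_subset_iff_six hbz hA hz0 4).1 hz4
  revert this
  decide

end IsCrossingFamily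

/-- in `ℝ³`, the five topoplanes `H₁ = {x₁ = 0}`, `H₂ = {x₂ = 0}`,
`H₃ = {x₂ = |x₁|}`, `H₄ = {x₃ = 0}`, `H₅ = {x₂ + x₃ = 0}` form an arrangement of
topoplanes, but there is no affine arrangement of topoplanes in `ℝ³` whose `k`-skeleton
equals the `k`-skeleton of this arrangement for every `0 ≤ k ≤ 3`. -/
theorem statement13 (H₁ H₂ H₃ H₄ H₅ : Set (Fin 3 → ℝ))
    (hH₁ : H₁ = {x | x 0 = 0}) (hH₂ : H₂ = {x | x 1 = 0})
    (hH₃ : H₃ = {x | x 1 = |x 0|}) (hH₄ : H₄ = {x | x 2 = 0})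
    (hH₅ : H₅ = {x | x 1 + x 2 = 0}) :
    IsArrangement {H₁, H₂, H₃, H₄, H₅} ∧
      ¬∃ 𝓗' : Set (Set (Fin 3 → ℝ)), IsArrangement 𝓗' ∧ PairwiseAffine 𝓗' ∧
        ∀ k ≤ 3, skeleton 𝓗' k = skeleton ({H₁, H₂, H₃, H₄, H₅} : Set (Set (Fin 3 → ℝ))) k := by
  subst hH₁ hH₂ hH₃ hH₄ hH₅
  refine ⟨isArrangement_fiveFamily, ?_⟩
  rintro ⟨𝓗', harr, haff, hskel⟩
  exact (isCrossingFamily_of_skeleton_eq harr haff hskel).false_of_isArrangement harr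
end

section
/- In ℝ³ let H₁ = {x : x₁ = −x₂}, H₂ = {x : x₁ = x₂}, and H₃ = {x : x₂ = f(x₃)} where f(t) = t − 1 for t ≥ 1, f(t) = 0 for −1 ≤ t ≤ 1, and f(t) = t + 1 for t ≤ −1. Then H₁, H₂, H₃ are topoplanes in ℝ³ and each of the pairwise intersections H₁ ∩ H₂, H₁ ∩ H₃, H₂ ∩ H₃ is a relative topoplane in each of the two topoplanes involved; nevertheless H₁ ∩ H₂ ∩ H₃ = {(0, 0, t) : −1 ≤ t ≤ 1}, and {H₁, H₂, H₃} is not an arrangement of topoplanes. -/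
open Set

/-- A set homeomorphic to `ℝᵈ⁺¹` through coordinates `p` with inverse parametrization `q` has
the zero set of the first coordinate as a relative topoplane. -/
theorem isRelTopoplane_of_chart {n d : ℕ} {Y Z : Set (Fin n → ℝ)} (hZY : Z ⊆ Y)
    (p : (Fin n → ℝ) → (Fin (d + 1) → ℝ)) (q : (Fin (d + 1) → ℝ) → (Fin n → ℝ))
    (hp : Continuous p) (hq : Continuous q) (hqY : ∀ z, q z ∈ Y)
    (hqp : ∀ y ∈ Y, q (p y) = y) (hpq : ∀ z, p (q z) = z)
    (hZ : ∀ y ∈ Y, y ∈ Z ↔ p y 0 = 0) : IsRelTopoplane Y Z := by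
  let φ : Y ≃ₜ (Fin (d + 1) → ℝ) :=
    { toFun := fun y => p y
      invFun := fun z => ⟨q z, hqY z⟩
      left_inv := fun y => Subtype.ext (hqp y y.2)
      right_inv := hpq
      continuous_toFun := hp.comp continuous_subtype_val
      continuous_invFun := hq.subtype_mk hqY }
  refine ⟨hZY, d + 1, d.succ_pos, φ, ?_⟩
  ext z
  constructor
  · rintro ⟨y, hy, rfl⟩ h
    exact (hZ y y.2).1 hy
  · intro h
    refine ⟨φ.symm z, (hZ _ (hqY z)).2 ?_, φ.apply_symm_apply z⟩
    rw [hpq]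
    exact h d.succ_pos

/-- The zero set of the first coordinate of a self-homeomorphism of `ℝⁿ` is a topoplane. -/
theorem isTopoplane_of_chart {n : ℕ} {H : Set (Fin (n + 1) → ℝ)}
    (p q : (Fin (n + 1) → ℝ) → (Fin (n + 1) → ℝ)) (hp : Continuous p) (hq : Continuous q)
    (hqp : ∀ x, q (p x) = x) (hpq : ∀ z, p (q z) = z)
    (hH : ∀ x, x ∈ H ↔ p x 0 = 0) : IsTopoplane H := by
  refine ⟨⟨⟨p, q, hqp, hpq⟩, hp, hq⟩, ?_⟩
  ext z
  constructor
  · rintro ⟨x, hx, rfl⟩ h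
    exact (hH x).1 hx
  · intro h
    refine ⟨q z, (hH _).2 ?_, hpq z⟩
    rw [hpq]
    exact h n.succ_pos

/-- If a coordinate hyperplane is compact, then it has at most one point. -/
theorem subsingleton_coordHyp_of_isCompact {d : ℕ} (h : IsCompact (coordHyp d 0)) :
    (coordHyp d 0).Subsingleton := by
  intro x hx y hy
  ext ⟨i, hi⟩
  rcases Nat.eq_zero_or_pos i with rfl | hpos
  · rw [hx hi, hy hi]
  · exfalso
    obtain ⟨M, hM⟩ := (h.image (continuous_apply (⟨i, hi⟩ : Fin d))).bddAbove
    have hmem : Pi.single (⟨i, hi⟩ : Fin d) (M + 1) ∈ coordHyp d 0 := by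
      intro h0
      exact Pi.single_eq_of_ne (by simp [Fin.ext_iff, hpos.ne]) _
    have := hM ⟨_, hmem, Pi.single_eq_same _ _⟩
    linarith

/-- A compact relative topoplane has at most one point. -/
theorem IsRelTopoplane.subsingleton_of_isCompact {n : ℕ} {Y Z : Set (Fin n → ℝ)}
    (h : IsRelTopoplane Y Z) (hZ : IsCompact Z) : Z.Subsingleton := by
  obtain ⟨hZY, d, -, φ, hφ⟩ := h
  have hcpt : IsCompact {y : Y | (y : Fin n → ℝ) ∈ Z} := by
    rw [Topology.IsInducing.subtypeVal.isCompact_iff]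
    change IsCompact (Subtype.val '' (Subtype.val ⁻¹' Z))
    rwa [Subtype.image_preimage_coe, inter_eq_right.2 hZY]
  have hsub := subsingleton_coordHyp_of_isCompact (hφ ▸ hcpt.image φ.continuous)
  intro x hx y hy
  have hxy := hsub (hφ ▸ mem_image_of_mem φ (show (⟨x, hZY hx⟩ : Y) ∈ _ from hx))
    (hφ ▸ mem_image_of_mem φ (show (⟨y, hZY hy⟩ : Y) ∈ _ from hy))
  exact congrArg Subtype.val (φ.injective hxy)

/-- The piecewise linear function vanishing exactly on `[-1, 1]`, with slope one elsewhere. -/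
theorem ite_eq_sub_clamp (t : ℝ) :
    (if 1 ≤ t then t - 1 else if t ≤ -1 then t + 1 else 0) = t - max (-1) (min 1 t) := by
  grind

theorem vec_two_eq {z : Fin 2 → ℝ} {a b : ℝ} (ha : a = z 0) (hb : b = z 1) : ![a, b] = z := by
  subst ha hb
  ext i
  fin_cases i <;> rfl

theorem vec_three_eq {z : Fin 3 → ℝ} {a b c : ℝ} (ha : a = z 0) (hb : b = z 1) (hc : c = z 2) :
    ![a, b, c] = z := by
  subst ha hb hc
  ext i
  fin_cases i <;> rfl

theorem continuous_vec_two {X : Type*} [TopologicalSpace X] {u v : X → ℝ}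
    (hu : Continuous u) (hv : Continuous v) : Continuous fun x => ![u x, v x] := by
  refine continuous_pi fun i => ?_
  fin_cases i <;> assumption

theorem continuous_vec_three_s15 {X : Type*} [TopologicalSpace X] {u v w : X → ℝ}
    (hu : Continuous u) (hv : Continuous v) (hw : Continuous w) :
    Continuous fun x => ![u x, v x, w x] := by
  refine continuous_pi fun i => ?_
  fin_cases i <;> assumption

theorem isTopoplane_slope (s : ℝ) : IsTopoplane {x : Fin 3 → ℝ | x 0 = s * x 1} := by
  refine isTopoplane_of_chart (fun x => ![x 0 - s * x 1, x 1, x 2])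
    (fun z => ![z 0 + s * z 1, z 1, z 2])
    (continuous_vec_three_s15 (by fun_prop) (by fun_prop) (by fun_prop))
    (continuous_vec_three_s15 (by fun_prop) (by fun_prop) (by fun_prop))
    (fun x => vec_three_eq ?_ ?_ ?_) (fun z => vec_three_eq ?_ ?_ ?_) (fun x => ?_)
  all_goals simp [sub_eq_zero]

theorem isTopoplane_graph {f : ℝ → ℝ} (hf : Continuous f) :
    IsTopoplane {x : Fin 3 → ℝ | x 1 = f (x 2)} := by
  refine isTopoplane_of_chart (fun x => ![x 1 - f (x 2), x 0, x 2])
    (fun z => ![z 1, z 0 + f (z 2), z 2])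
    (continuous_vec_three_s15 (by fun_prop) (by fun_prop) (by fun_prop))
    (continuous_vec_three_s15 (by fun_prop) (by fun_prop) (by fun_prop))
    (fun x => vec_three_eq ?_ ?_ ?_) (fun z => vec_three_eq ?_ ?_ ?_) (fun x => ?_)
  all_goals simp [sub_eq_zero]

theorem isRelTopoplane_slope_slope {s s' : ℝ} (hs : s ≠ s') :
    IsRelTopoplane {x : Fin 3 → ℝ | x 0 = s * x 1}
      ({x | x 0 = s * x 1} ∩ {x | x 0 = s' * x 1}) := by
  refine isRelTopoplane_of_chart inter_subset_left (fun x => ![x 1, x 2])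
    (fun z => ![s * z 0, z 0, z 1])
    (continuous_vec_two (by fun_prop) (by fun_prop))
    (continuous_vec_three_s15 (by fun_prop) (by fun_prop) (by fun_prop))
    (fun z => rfl) (fun x hx => vec_three_eq hx.symm rfl rfl)
    (fun z => vec_two_eq rfl rfl) (fun x (hx : x 0 = s * x 1) => ?_)
  have hiff : s * x 1 = s' * x 1 ↔ x 1 = 0 := by simp [hs]
  simpa [hx] using hiff

theorem isRelTopoplane_slope_graph (s : ℝ) {f : ℝ → ℝ} (hf : Continuous f) :
    IsRelTopoplane {x : Fin 3 → ℝ | x 0 = s * x 1}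
      ({x | x 0 = s * x 1} ∩ {x | x 1 = f (x 2)}) := by
  refine isRelTopoplane_of_chart inter_subset_left (fun x => ![x 1 - f (x 2), x 2])
    (fun z => ![s * (z 0 + f (z 1)), z 0 + f (z 1), z 1])
    (continuous_vec_two (by fun_prop) (by fun_prop))
    (continuous_vec_three_s15 (by fun_prop) (by fun_prop) (by fun_prop))
    (fun z => rfl) (fun x (hx : x 0 = s * x 1) => vec_three_eq ?_ ?_ rfl)
    (fun z => vec_two_eq ?_ rfl) (fun x (hx : x 0 = s * x 1) => ?_)
  · simp [hx]
  · simp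
  · simp
  · simp [hx, sub_eq_zero]

theorem isRelTopoplane_graph_slope (s : ℝ) {f : ℝ → ℝ} (hf : Continuous f) :
    IsRelTopoplane {x : Fin 3 → ℝ | x 1 = f (x 2)}
      ({x | x 0 = s * x 1} ∩ {x | x 1 = f (x 2)}) := by
  refine isRelTopoplane_of_chart inter_subset_right (fun x => ![x 0 - s * x 1, x 2])
    (fun z => ![z 0 + s * f (z 1), f (z 1), z 1])
    (continuous_vec_two (by fun_prop) (by fun_prop))
    (continuous_vec_three_s15 (by fun_prop) (by fun_prop) (by fun_prop))
    (fun z => rfl) (fun x (hx : x 1 = f (x 2)) => vec_three_eq ?_ hx.symm rfl)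
    (fun z => vec_two_eq ?_ rfl) (fun x (hx : x 1 = f (x 2)) => ?_)
  · simp [hx]
  · simp
  · simp [hx, sub_eq_zero]

/-- in `ℝ³`, let `H₁ = {x₁ = -x₂}`, `H₂ = {x₁ = x₂}` and
`H₃ = {x₂ = f(x₃)}` where `f(t) = t - 1` for `t ≥ 1`, `f(t) = 0` for `-1 ≤ t ≤ 1`, and
`f(t) = t + 1` for `t ≤ -1`.  Then `H₁, H₂, H₃` are topoplanes, each pairwise intersection
is a relative topoplane in each of the two topoplanes involved, yet
`H₁ ∩ H₂ ∩ H₃ = {(0,0,t) : -1 ≤ t ≤ 1}` and `{H₁, H₂, H₃}` is not an arrangement of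
topoplanes. -/
theorem statement15 (H₁ H₂ H₃ : Set (Fin 3 → ℝ))
    (hH₁ : H₁ = {x | x 0 = -(x 1)}) (hH₂ : H₂ = {x | x 0 = x 1})
    (hH₃ : H₃ = {x | x 1 = if 1 ≤ x 2 then x 2 - 1 else if x 2 ≤ -1 then x 2 + 1 else 0}) :
    (IsTopoplane H₁ ∧ IsTopoplane H₂ ∧ IsTopoplane H₃) ∧
      (IsRelTopoplane H₁ (H₁ ∩ H₂) ∧ IsRelTopoplane H₂ (H₁ ∩ H₂) ∧
        IsRelTopoplane H₁ (H₁ ∩ H₃) ∧ IsRelTopoplane H₃ (H₁ ∩ H₃) ∧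
        IsRelTopoplane H₂ (H₂ ∩ H₃) ∧ IsRelTopoplane H₃ (H₂ ∩ H₃)) ∧
      H₁ ∩ H₂ ∩ H₃ = {x | x 0 = 0 ∧ x 1 = 0 ∧ -1 ≤ x 2 ∧ x 2 ≤ 1} ∧
      ¬IsArrangement {H₁, H₂, H₃} := by
  obtain ⟨f, hf, hf_def⟩ : ∃ f : ℝ → ℝ, Continuous f ∧
      ∀ t, f t = if 1 ≤ t then t - 1 else if t ≤ -1 then t + 1 else 0 :=
    ⟨fun t => t - max (-1) (min 1 t), by fun_prop, fun t => (ite_eq_sub_clamp t).symm⟩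
  have hinter : H₁ ∩ H₂ ∩ H₃ = {x | x 0 = 0 ∧ x 1 = 0 ∧ -1 ≤ x 2 ∧ x 2 ≤ 1} := by
    subst hH₁ hH₂ hH₃
    ext x
    simp only [mem_inter_iff, mem_ofPred_eq]
    grind
  replace hH₁ : H₁ = {x | x 0 = -1 * x 1} := by simpa using hH₁
  replace hH₂ : H₂ = {x | x 0 = 1 * x 1} := by simpa using hH₂
  simp only [← hf_def] at hH₃
  refine ⟨⟨?_, ?_, ?_⟩, ⟨?_, ?_, ?_, ?_, ?_, ?_⟩, hinter, ?_⟩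
  · exact hH₁ ▸ isTopoplane_slope (-1)
  · exact hH₂ ▸ isTopoplane_slope 1
  · exact hH₃ ▸ isTopoplane_graph hf
  · rw [hH₁, hH₂]
    exact isRelTopoplane_slope_slope (by norm_num)
  · rw [inter_comm, hH₁, hH₂]
    exact isRelTopoplane_slope_slope (by norm_num)
  · rw [hH₁, hH₃]
    exact isRelTopoplane_slope_graph (-1) hf
  · rw [hH₁, hH₃]
    exact isRelTopoplane_graph_slope (-1) hf
  · rw [hH₂, hH₃]
    exact isRelTopoplane_slope_graph 1 hf
  · rw [hH₂, hH₃]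
    exact isRelTopoplane_graph_slope 1 hf
  · rintro ⟨-, -, h⟩
    have hseg : ∀ t : ℝ, -1 ≤ t → t ≤ 1 → ![0, 0, t] ∈ H₃ ∩ (H₁ ∩ H₂) := by
      intro t h1 h2
      rw [inter_comm, hinter]
      exact ⟨rfl, rfl, h1, h2⟩
    have hflat : IsFlat {H₁, H₂, H₃} (H₁ ∩ H₂) :=
      ⟨⟨{H₁, H₂}, by grind, (sInter_pair _ _).symm⟩,
        ![0, 0, 0], (hseg 0 (by norm_num) (by norm_num)).2⟩
    rcases h H₃ (by simp) _ hflat with hsub | hempty | hrel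
    · have hmem : ![0, 0, 2] ∈ H₁ ∩ H₂ ∩ H₃ := by
        have h12 : ![0, 0, 2] ∈ H₁ ∩ H₂ := by simp [hH₁, hH₂]
        exact ⟨h12, hsub h12⟩
      rw [hinter] at hmem
      have h2 : (2 : ℝ) ≤ 1 := hmem.2.2.2
      norm_num at h2
    · exact (hempty ▸ hseg 0 (by norm_num) (by norm_num) : _ ∈ (∅ : Set (Fin 3 → ℝ)))
    · have hcpt : IsCompact (H₃ ∩ (H₁ ∩ H₂)) := by
        have himage : H₃ ∩ (H₁ ∩ H₂) = (fun t : ℝ => ![0, 0, t]) '' Icc (-1) 1 := by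
          refine Subset.antisymm ?_ ?_
          · rw [inter_comm, hinter]
            rintro x ⟨h0, h1, h2⟩
            exact ⟨x 2, h2, vec_three_eq h0.symm h1.symm rfl⟩
          · rintro _ ⟨t, ht, rfl⟩
            exact hseg t ht.1 ht.2
        rw [himage]
        exact isCompact_Icc.image
          (continuous_vec_three_s15 continuous_const continuous_const continuous_id)
      have heq := hrel.subsingleton_of_isCompact hcpt
        (hseg 0 (by norm_num) (by norm_num)) (hseg 1 (by norm_num) le_rfl)
      have h01 : (0 : ℝ) = 1 := congrFun heq 2
      norm_num at h01
end
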